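/- arXiv:1403.5217 — 2 statements merged into one kernel-verified Lean document; each statement's English description precedes it below -/
import Mathlib

section
/- For every d ≥ 2 there exists a contractible (indeed collapsible) d-dimensional simplicial complex that does not topologically embed in ℝ^(2d−1). -/
/-- A finite abstract simplicial complex on vertex set `V`: a downward-closed
family of nonempty finite sets. -/
structure SimplicialCx (V : Type) [DecidableEq V] where
  faces : Finset (Finset V)
  nonempty_of_mem : ∀ σ ∈ faces, σ.Nonempty
  down_closed : ∀ σ ∈ faces, ∀ τ, τ ⊆ σ → τ.Nonempty → τ ∈ faces

variable {V : Type} [DecidableEq V]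

/-- An elementary collapse removes a free pair `(σ, σ')`: `σ'` is the unique face
of `C` properly containing `σ`, and `dim σ' = dim σ + 1`. -/
def IsElementaryCollapse (C C' : SimplicialCx V) : Prop :=
  ∃ σ σ' : Finset V, σ ∈ C.faces ∧ σ' ∈ C.faces ∧ σ ⊂ σ' ∧
    σ'.card = σ.card + 1 ∧ (∀ τ ∈ C.faces, σ ⊂ τ → τ = σ') ∧
    C'.faces = C.faces \ {σ, σ'}

/-- A complex is collapsible if a sequence of elementary collapses reduces it to
a single vertex. -/
def Collapsible (C : SimplicialCx V) : Prop :=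
  ∃ C' : SimplicialCx V, Relation.ReflTransGen IsElementaryCollapse C C' ∧
    ∃ v : V, C'.faces = {{v}}

/-- A linear embedding of `C` in `ℝ^m`: vertices go to points such that each face
spans an affinely independent set, and the geometric simplices of two faces meet
exactly in the geometric simplex of their common face. -/
def LinearlyEmbeds (C : SimplicialCx V) (m : ℕ) : Prop :=
  ∃ f : V → EuclideanSpace ℝ (Fin m),
    (∀ σ ∈ C.faces, AffineIndependent ℝ (fun x : σ => f x)) ∧
    ∀ σ ∈ C.faces, ∀ τ ∈ C.faces,
      convexHull ℝ (f '' ↑σ) ∩ convexHull ℝ (f '' ↑τ)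
        = convexHull ℝ (f '' ↑(σ ∩ τ))

/-- The geometric realization of a finite simplicial complex on vertex set `V`,
as a subspace of `V → ℝ`: convex weight functions supported on a face. -/
def realization {V : Type} [DecidableEq V] [Fintype V] (C : SimplicialCx V) :
    Set (V → ℝ) :=
  {w | ∃ σ ∈ C.faces, (∀ v, 0 ≤ w v) ∧ (∀ v, v ∉ σ → w v = 0) ∧ ∑ v ∈ σ, w v = 1}

/-- A topological embedding of `C` in `ℝ^m`: a topological embedding of the
geometric realization of `C` into `ℝ^m`. -/
def TopologicallyEmbeds {V : Type} [DecidableEq V] [Fintype V]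
    (C : SimplicialCx V) (m : ℕ) : Prop :=
  ∃ f : ↥(realization C) → EuclideanSpace ℝ (Fin m), Topology.IsEmbedding f

namespace ListChain

variable {E F : Type*}

/-- The cone operator on mod 2 chains of ordered simplices: prepend a vertex. -/
noncomputable def cone (a : E) : (List E →₀ ZMod 2) →ₗ[ZMod 2] (List E →₀ ZMod 2) :=
  Finsupp.lmapDomain _ _ (List.cons a)

/-- The sum of the facets of an ordered simplex. -/
noncomputable def facets : List E → (List E →₀ ZMod 2)
  | [] => 0
  | a :: l => Finsupp.single l 1 + cone a (facets l)

/-- The (augmented) boundary operator on mod 2 chains of ordered simplices. -/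
noncomputable def boundary : (List E →₀ ZMod 2) →ₗ[ZMod 2] (List E →₀ ZMod 2) :=
  Finsupp.linearCombination (ZMod 2) facets

/-- The chain map induced by a map of vertices. -/
noncomputable def map (f : E → F) : (List E →₀ ZMod 2) →ₗ[ZMod 2] (List F →₀ ZMod 2) :=
  Finsupp.lmapDomain _ _ (List.map f)

@[simp] lemma cone_single (a : E) (l : List E) (r : ZMod 2) :
    cone a (Finsupp.single l r) = Finsupp.single (a :: l) r := by
  simp [cone]

@[simp] lemma map_single (f : E → F) (l : List E) (r : ZMod 2) :
    map f (Finsupp.single l r) = Finsupp.single (l.map f) r := by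
  simp [map]

@[simp] lemma boundary_single (l : List E) : boundary (Finsupp.single l 1) = facets l := by
  simp [boundary]

@[simp] lemma boundary_cone (a : E) (c : List E →₀ ZMod 2) :
    boundary (cone a c) = c + cone a (boundary c) := by
  suffices h : boundary ∘ₗ cone a = LinearMap.id + cone a ∘ₗ boundary from
    LinearMap.congr_fun h c
  ext1 l
  ext1
  simp [facets]

@[simp] lemma map_cone (f : E → F) (a : E) (c : List E →₀ ZMod 2) :
    map f (cone a c) = cone (f a) (map f c) := by
  suffices h : map f ∘ₗ cone a = cone (f a) ∘ₗ map f from LinearMap.congr_fun h c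
  ext1 l
  ext1
  simp

lemma map_facets (f : E → F) (l : List E) : map f (facets l) = facets (l.map f) := by
  induction l with
  | nil => simp [facets]
  | cons a l ih => simp [facets, ih]

lemma boundary_map (f : E → F) (c : List E →₀ ZMod 2) :
    boundary (map f c) = map f (boundary c) := by
  suffices h : boundary ∘ₗ map f = map f ∘ₗ boundary from LinearMap.congr_fun h c
  ext1 l
  ext1
  simp [map_facets]

lemma boundary_facets (l : List E) : boundary (facets l) = 0 := by
  induction l with
  | nil => simp [facets]
  | cons a l ih => simp [facets, ih, ZModModule.add_self]

lemma boundary_boundary (c : List E →₀ ZMod 2) : boundary (boundary c) = 0 := by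
  suffices h : boundary ∘ₗ boundary = (0 : (List E →₀ ZMod 2) →ₗ[ZMod 2] _) from
    LinearMap.congr_fun h c
  ext1 l
  ext1
  simp [boundary_facets]

lemma mem_supported_of_single {P : Set (List E)} {Q : Set (List F)}
    (g : (List E →₀ ZMod 2) →ₗ[ZMod 2] (List F →₀ ZMod 2))
    (h : ∀ l ∈ P, g (Finsupp.single l 1) ∈ Finsupp.supported (ZMod 2) (ZMod 2) Q)
    {c : List E →₀ ZMod 2} (hc : c ∈ Finsupp.supported (ZMod 2) (ZMod 2) P) :
    g c ∈ Finsupp.supported (ZMod 2) (ZMod 2) Q := by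
  rw [Finsupp.supported_eq_span_single] at hc
  refine Submodule.span_induction ?_ ?_ ?_ ?_ hc
  · rintro _ ⟨l, hl, rfl⟩
    exact h l hl
  · simp
  · intro x y _ _ hx hy
    rw [map_add]
    exact add_mem hx hy
  · intro r x _ hx
    rw [map_smul]
    exact Submodule.smul_mem _ r hx

lemma cone_mem_supported {P Q : Set (List E)} {a : E} (h : ∀ l ∈ P, a :: l ∈ Q)
    {c : List E →₀ ZMod 2} (hc : c ∈ Finsupp.supported (ZMod 2) (ZMod 2) P) :
    cone a c ∈ Finsupp.supported (ZMod 2) (ZMod 2) Q := by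
  refine mem_supported_of_single _ (fun l hl => ?_) hc
  rw [cone_single]
  exact Finsupp.single_mem_supported _ _ (h l hl)

lemma map_mem_supported {P : Set (List E)} {Q : Set (List F)} {f : E → F}
    (h : ∀ l ∈ P, l.map f ∈ Q)
    {c : List E →₀ ZMod 2} (hc : c ∈ Finsupp.supported (ZMod 2) (ZMod 2) P) :
    map f c ∈ Finsupp.supported (ZMod 2) (ZMod 2) Q := by
  refine mem_supported_of_single _ (fun l hl => ?_) hc
  rw [map_single]
  exact Finsupp.single_mem_supported _ _ (h l hl)

lemma facets_mem_supported (l : List E) :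
    facets l ∈ Finsupp.supported (ZMod 2) (ZMod 2)
      {l' | l'.length + 1 = l.length ∧ l' ⊆ l} := by
  induction l with
  | nil => simp [facets]
  | cons a l ih =>
    refine add_mem (Finsupp.single_mem_supported _ _ (by simp)) (cone_mem_supported ?_ ih)
    rintro l' ⟨h1, h2⟩
    exact ⟨by simpa using h1, List.cons_subset_cons a h2⟩

section Cochain

variable (s : ℕ → E → ZMod 2)

/-- The cup product of the coboundaries of the vertex functions `s (k - 1), …, s 0`. -/
def cupCoboundary : ℕ → List E → ZMod 2
  | 0, [_] => 1
  | k + 1, a :: b :: l => (s k a + s k b) * cupCoboundary k (b :: l)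
  | _, _ => 0

/-- The cup product of `s k` with the coboundaries of `s (k - 1), …, s 0`. -/
def cupCochain (k : ℕ) : List E → ZMod 2
  | [] => 0
  | a :: l => s k a * cupCoboundary s k (a :: l)

/-- Evaluation of a mod 2 cochain on chains. -/
noncomputable def eval (φ : List E → ZMod 2) : (List E →₀ ZMod 2) →ₗ[ZMod 2] ZMod 2 :=
  Finsupp.linearCombination (ZMod 2) φ

@[simp] lemma eval_single (φ : List E → ZMod 2) (l : List E) :
    eval φ (Finsupp.single l 1) = φ l := by
  simp [eval]

lemma eval_cupCochain_cone (k : ℕ) (a : E) (c : List E →₀ ZMod 2) :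
    eval (cupCochain s k) (cone a c) = s k a * eval (cupCoboundary s k) (cone a c) := by
  suffices h : eval (cupCochain s k) ∘ₗ cone a = s k a • eval (cupCoboundary s k) ∘ₗ cone a from
    LinearMap.congr_fun h c
  ext l
  simp [cupCochain]

lemma cupCoboundary_nil (k : ℕ) : cupCoboundary s k [] = 0 := by
  cases k <;> rfl

lemma eval_cupCochain_facets (k : ℕ) (l : List E)
    (h : ∀ l, eval (cupCoboundary s k) (facets l) = 0) :
    eval (cupCochain s k) (facets l) = cupCoboundary s (k + 1) l := by
  match l with
  | [] => simp [facets, cupCoboundary]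
  | [a] => simp [facets, cupCoboundary, cupCochain]
  | a :: b :: t =>
    have h1 : cupCoboundary s k (b :: t)
        = eval (cupCoboundary s k) (cone a (facets (b :: t))) := by
      have := h (a :: b :: t)
      rw [facets, map_add, eval_single] at this
      rw [eq_neg_of_add_eq_zero_left this, ZModModule.neg_eq_self]
    rw [facets, map_add, eval_single, eval_cupCochain_cone, ← h1]
    simp only [cupCochain, cupCoboundary]
    ring

lemma eval_cupCoboundary_facets (k : ℕ) (l : List E) :
    eval (cupCoboundary s k) (facets l) = 0 := by
  induction k generalizing l with
  | zero =>
    match l with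
    | [] => simp [facets]
    | [a] => simp [facets, cupCoboundary]
    | [a, b] => simp [facets, cupCoboundary, ZModModule.add_self]
    | a :: b :: c :: t =>
      have h : ∀ u, eval (cupCoboundary s 0) (cone a (cone b u)) = 0 := by
        intro u
        suffices h : eval (cupCoboundary s 0) ∘ₗ cone a ∘ₗ cone b = 0 from
          LinearMap.congr_fun h u
        ext l
        simp [cupCoboundary]
      rw [facets, facets, map_add, map_add, map_add, h]
      simp [cupCoboundary]
  | succ k ih =>
    have h : eval (cupCoboundary s (k + 1)) = eval (cupCochain s k) ∘ₗ boundary := by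
      ext l
      simp [eval_cupCochain_facets s k l ih]
    rw [h, LinearMap.comp_apply, boundary_facets, map_zero]

lemma eval_cupCochain_boundary (k : ℕ) (c : List E →₀ ZMod 2) :
    eval (cupCochain s k) (boundary c) = eval (cupCoboundary s (k + 1)) c := by
  suffices h : eval (cupCochain s k) ∘ₗ boundary = eval (cupCoboundary s (k + 1)) from
    LinearMap.congr_fun h c
  ext l
  simp [eval_cupCochain_facets s k l (eval_cupCoboundary_facets s k)]

lemma cupCoboundary_map {T : E → E} (k : ℕ) (l : List E)
    (h : ∀ i, ∀ x ∈ l, s i (T x) = s i x + 1) :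
    cupCoboundary s k (l.map T) = cupCoboundary s k l := by
  induction k generalizing l with
  | zero =>
    match l with
    | [] => rfl
    | [a] => rfl
    | a :: b :: t => rfl
  | succ k ih =>
    match l with
    | [] => rfl
    | [a] => rfl
    | a :: b :: t =>
      have := ih (b :: t) fun i x hx => h i x (List.mem_cons_of_mem _ hx)
      simp only [List.map_cons] at this ⊢
      simp only [cupCoboundary, this, h k a (by simp), h k b (by simp)]
      have h2 : (1 + 1 : ZMod 2) = 0 := rfl
      linear_combination cupCoboundary s k (b :: t) * h2

lemma eval_cupCochain_add_map {T : E → E} (k : ℕ) {c : List E →₀ ZMod 2}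
    (hc : c ∈ Finsupp.supported (ZMod 2) (ZMod 2)
      {l | ∀ i, ∀ x ∈ l, s i (T x) = s i x + 1}) :
    eval (cupCochain s k) (c + map T c) = eval (cupCoboundary s k) c := by
  rw [Finsupp.supported_eq_span_single] at hc
  refine Submodule.span_induction ?_ ?_ ?_ ?_ hc
  · rintro _ ⟨l, hl, rfl⟩
    rw [map_add, map_single, eval_single, eval_single, eval_single]
    match l, hl with
    | [], _ => simp [cupCochain, cupCoboundary_nil]
    | a :: t, hl =>
      have h1 := cupCoboundary_map s k _ hl
      simp only [List.map_cons] at h1 ⊢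
      simp only [cupCochain, h1, hl k a (by simp)]
      have h2 : (1 + 1 : ZMod 2) = 0 := rfl
      linear_combination s k a * cupCoboundary s k (a :: t) * h2
  · simp
  · intro x y _ _ hx hy
    rw [map_add (eval (cupCoboundary s k)), ← hx, ← hy, ← map_add, map_add (map T)]
    congr 1
    abel
  · intro r x _ hx
    rw [map_smul (eval (cupCoboundary s k)), ← hx, ← map_smul, map_smul, smul_add]

lemma exists_ne_of_cupCoboundary_ne_zero (k : ℕ) (l : List E) (h : cupCoboundary s k l ≠ 0)
    (i : ℕ) (hi : i < k) : ∃ a ∈ l, ∃ b ∈ l, s i a ≠ s i b := by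
  induction k generalizing l with
  | zero => omega
  | succ k ih =>
    match l with
    | [] => simp [cupCoboundary] at h
    | [a] => simp [cupCoboundary] at h
    | a :: b :: t =>
      rw [cupCoboundary] at h
      rcases Nat.lt_succ_iff_lt_or_eq.1 hi with hi | rfl
      · obtain ⟨x, hx, y, hy, hxy⟩ := ih (b :: t) (right_ne_zero_of_mul h) hi
        exact ⟨x, List.mem_cons_of_mem _ hx, y, List.mem_cons_of_mem _ hy, hxy⟩
      · refine ⟨a, by simp, b, by simp, fun hab => left_ne_zero_of_mul h ?_⟩
        rw [hab, ZModModule.add_self]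

/-- A sequence of chains `H k` in which the boundary of `H (k + 1)` is `H k` plus its image under
the involution detects the cup products of the coboundaries of odd vertex functions. -/
lemma eval_cupCoboundary_eq_one {T : E → E} {H : ℕ → (List E →₀ ZMod 2)} {x : E}
    (h0 : H 0 = Finsupp.single [x] 1) (n : ℕ)
    (hbd : ∀ k < n, boundary (H (k + 1)) = H k + map T (H k))
    (hs : ∀ k < n, H k ∈ Finsupp.supported (ZMod 2) (ZMod 2)
      {l | ∀ i, ∀ x ∈ l, s i (T x) = s i x + 1}) :
    eval (cupCoboundary s n) (H n) = 1 := by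
  induction n with
  | zero => simp [h0, cupCoboundary]
  | succ n ih =>
    rw [← eval_cupCochain_boundary, hbd n n.lt_succ_self,
      eval_cupCochain_add_map s n (hs n n.lt_succ_self)]
    exact ih (fun k hk => hbd k (hk.trans n.lt_succ_self))
      fun k hk => hs k (hk.trans n.lt_succ_self)

end Cochain

section Subdivision

variable {E : Type*} [NormedAddCommGroup E] [NormedSpace ℝ E]

/-- The barycenter of a list of points. -/
noncomputable def barycenter (l : List E) : E := (l.length : ℝ)⁻¹ • l.sum

/-- Barycentric subdivision of ordered simplices with `k` vertices. -/
noncomputable def subdiv : ℕ → (List E →₀ ZMod 2) →ₗ[ZMod 2] (List E →₀ ZMod 2)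
  | 0 => LinearMap.id
  | k + 1 => Finsupp.linearCombination (ZMod 2)
      fun l => cone (barycenter l) (subdiv k (facets l))

lemma subdiv_succ_single (k : ℕ) (l : List E) :
    subdiv (k + 1) (Finsupp.single l 1) = cone (barycenter l) (subdiv k (facets l)) := by
  simp [subdiv]

lemma boundary_subdiv_succ (k : ℕ) (c : List E →₀ ZMod 2) :
    boundary (subdiv (k + 1) c) = subdiv k (boundary c) := by
  suffices h : boundary ∘ₗ subdiv (k + 1) = subdiv k ∘ₗ (boundary (E := E)) from
    LinearMap.congr_fun h c
  induction k with
  | zero =>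
    ext1 l
    ext1
    simp [subdiv, boundary_facets]
  | succ k ih =>
    ext1 l
    ext1
    have := LinearMap.congr_fun ih (facets l)
    simp only [LinearMap.comp_apply, boundary_facets, map_zero] at this
    simp [subdiv_succ_single, this]

lemma barycenter_map_neg (l : List E) : barycenter (l.map Neg.neg) = -barycenter l := by
  have h : (l.map Neg.neg).sum = -l.sum := by
    induction l with
    | nil => simp
    | cons a l ih => rw [List.map_cons, List.sum_cons, List.sum_cons, ih, neg_add]
  simp [barycenter, h]

lemma subdiv_map_neg (k : ℕ) (c : List E →₀ ZMod 2) :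
    subdiv k (map Neg.neg c) = map Neg.neg (subdiv k c) := by
  suffices h : subdiv k ∘ₗ map Neg.neg = map Neg.neg ∘ₗ subdiv (E := E) k from
    LinearMap.congr_fun h c
  induction k with
  | zero => rfl
  | succ k ih =>
    ext1 l
    ext1
    have := LinearMap.congr_fun ih (facets l)
    simp only [LinearMap.comp_apply] at this
    simp [subdiv_succ_single, barycenter_map_neg, ← this, map_facets]

lemma boundary_subdiv_iterate (k r : ℕ) (c : List E →₀ ZMod 2) :
    boundary ((subdiv (k + 1))^[r] c) = (subdiv k)^[r] (boundary c) :=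
  (Function.Semiconj.iterate_right (f := boundary) (boundary_subdiv_succ k) r) c

lemma subdiv_iterate_map_neg (k r : ℕ) (c : List E →₀ ZMod 2) :
    (subdiv k)^[r] (map Neg.neg c) = map Neg.neg ((subdiv k)^[r] c) :=
  ((Function.Semiconj.iterate_right (f := map Neg.neg)
    (fun c => (subdiv_map_neg k c).symm) r) c).symm

lemma subdiv_iterate_single_singleton (r : ℕ) (x : E) :
    (subdiv 1)^[r] (Finsupp.single [x] 1) = Finsupp.single [x] 1 := by
  refine Function.iterate_fixed ?_ r
  simp [subdiv, facets, barycenter]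

lemma barycenter_mem {A : Set E} (hA : Convex ℝ A) {l : List E} (hl : l ≠ [])
    (h : ∀ x ∈ l, x ∈ A) : barycenter l ∈ A := by
  have h0 : (l.length : ℝ) ≠ 0 := by simpa using hl
  have : barycenter l = ∑ i : Fin l.length, (l.length : ℝ)⁻¹ • l.get i := by
    rw [← Finset.smul_sum, barycenter]
    congr 1
    rw [← List.sum_ofFn, List.ofFn_get]
  rw [this]
  refine hA.sum_mem (fun _ _ => by positivity) ?_ fun i _ => h _ (List.get_mem l i)
  simp [h0]

lemma dist_barycenter_le {l : List E} {N : ℕ} (hN : l.length ≤ N) {D : ℝ} {x : E} (hx : x ∈ l)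
    (h : ∀ y ∈ l, dist x y ≤ D) : dist x (barycenter l) ≤ (1 - (N : ℝ)⁻¹) * D := by
  have hpos : (0 : ℝ) < l.length := by exact_mod_cast List.length_pos_of_mem hx
  have hD : 0 ≤ D := dist_nonneg.trans (h x hx)
  obtain ⟨l₁, l₂, rfl⟩ := List.append_of_mem hx
  have key : ∀ l : List E, (∀ y ∈ l, dist x y ≤ D) →
      ‖(l.length : ℝ) • x - l.sum‖ ≤ l.length * D := by
    intro l hl
    induction l with
    | nil => simp
    | cons a l ih =>
      have h1 := ih fun y hy => hl y (List.mem_cons_of_mem _ hy)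
      have h2 : ‖x - a‖ ≤ D := by simpa [dist_eq_norm] using hl a (by simp)
      calc ‖((a :: l).length : ℝ) • x - (a :: l).sum‖
          = ‖((l.length : ℝ) • x - l.sum) + (x - a)‖ := by
            congr 1
            simp only [List.length_cons, List.sum_cons, Nat.cast_add, Nat.cast_one, add_smul,
              one_smul]
            abel
        _ ≤ l.length * D + D := (norm_add_le _ _).trans (add_le_add h1 h2)
        _ = _ := by simp; ring
  have h3 := key (l₁ ++ l₂) fun y hy => h y (by
    simp only [List.mem_append, List.mem_cons] at hy ⊢
    tauto)
  set m : ℝ := ((l₁ ++ l₂).length : ℝ) with hm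
  have hlen : ((l₁ ++ x :: l₂).length : ℝ) = m + 1 := by
    rw [hm]; simp; ring
  have hm0 : 0 ≤ m := by positivity
  have h4 : x - barycenter (l₁ ++ x :: l₂) = (m + 1)⁻¹ • (m • x - (l₁ ++ l₂).sum) := by
    have hx' : x = (m + 1)⁻¹ • ((m + 1) • x) := by
      rw [smul_smul, inv_mul_cancel₀ (by positivity), one_smul]
    rw [barycenter, hlen]
    conv_lhs => rw [hx', ← smul_sub]
    congr 1
    rw [← hx']
    simp only [List.sum_append, List.sum_cons, add_smul, one_smul]
    abel
  have hN' : m + 1 ≤ N := by rw [← hlen]; exact_mod_cast hN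
  rw [dist_eq_norm, h4, norm_smul, Real.norm_of_nonneg (by positivity)]
  calc (m + 1)⁻¹ * ‖m • x - (l₁ ++ l₂).sum‖ ≤ (m + 1)⁻¹ * (m * D) := by gcongr
    _ = (1 - (m + 1)⁻¹) * D := by field_simp; ring
    _ ≤ (1 - (N : ℝ)⁻¹) * D := by gcongr

lemma subdiv_single_mem_supported {N : ℕ} (k : ℕ) (hkN : k ≤ N) {l : List E} (hl : l.length ≤ k)
    {D : ℝ} (hD : ∀ x ∈ l, ∀ y ∈ l, dist x y ≤ D) {A : Set E} (hA : Convex ℝ A)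
    (hlA : ∀ x ∈ l, x ∈ A) :
    subdiv k (Finsupp.single l 1) ∈ Finsupp.supported (ZMod 2) (ZMod 2)
      {l' | l'.length ≤ k ∧ (∀ x ∈ l', x ∈ A) ∧
        ∀ x ∈ l', ∀ y ∈ l', dist x y ≤ (1 - (N : ℝ)⁻¹) * D} := by
  induction k generalizing l A with
  | zero =>
    obtain rfl : l = [] := by simpa using hl
    exact Finsupp.single_mem_supported _ _ (by simp)
  | succ k ih =>
    rw [subdiv_succ_single]
    rcases eq_or_ne l [] with rfl | hne
    · simp [facets]
    obtain ⟨x₀, hx₀⟩ := List.exists_mem_of_ne_nil l hne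
    have hD0 : 0 ≤ D := dist_nonneg.trans (hD x₀ hx₀ x₀ hx₀)
    have hN1 : (N : ℝ)⁻¹ ≤ 1 := inv_le_one_of_one_le₀ (by exact_mod_cast (by omega : 1 ≤ N))
    have hq : 0 ≤ (1 - (N : ℝ)⁻¹) * D := mul_nonneg (by linarith) hD0
    have hball : ∀ x ∈ l, x ∈ A ∩ Metric.closedBall (barycenter l) ((1 - (N : ℝ)⁻¹) * D) :=
      fun x hx => ⟨hlA x hx, dist_barycenter_le (hl.trans hkN) hx (hD x hx)⟩
    refine cone_mem_supported (P := {l' | l'.length ≤ k ∧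
        (∀ x ∈ l', x ∈ A ∩ Metric.closedBall (barycenter l) ((1 - (N : ℝ)⁻¹) * D)) ∧
        ∀ x ∈ l', ∀ y ∈ l', dist x y ≤ (1 - (N : ℝ)⁻¹) * D}) ?_ ?_
    · rintro l' ⟨h1, h2, h3⟩
      refine ⟨by simpa using h1, ?_, ?_⟩
      · simp only [List.mem_cons, forall_eq_or_imp]
        exact ⟨barycenter_mem hA hne hlA, fun x hx => (h2 x hx).1⟩
      · simp only [List.mem_cons, forall_eq_or_imp, dist_self]
        exact ⟨⟨hq, fun y hy => by rw [dist_comm]; exact (h2 y hy).2⟩,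
          fun x hx => ⟨(h2 x hx).2, h3 x hx⟩⟩
    · refine mem_supported_of_single _ ?_ (facets_mem_supported l)
      rintro l' ⟨h1, h2⟩
      exact ih (by omega) (by omega) (fun x hx y hy => hD x (h2 hx) y (h2 hy))
        (hA.inter (convex_closedBall _ _)) fun x hx => hball x (h2 hx)

lemma subdiv_iterate_mem_supported {ι : Type*} {A : ι → Set E} (hA : ∀ i, Convex ℝ (A i))
    (k r : ℕ) {D : ℝ} {c : List E →₀ ZMod 2}
    (hc : c ∈ Finsupp.supported (ZMod 2) (ZMod 2)
      {l | l.length ≤ k ∧ (∃ i, ∀ x ∈ l, x ∈ A i) ∧ ∀ x ∈ l, ∀ y ∈ l, dist x y ≤ D}) :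
    (subdiv k)^[r] c ∈ Finsupp.supported (ZMod 2) (ZMod 2)
      {l | l.length ≤ k ∧ (∃ i, ∀ x ∈ l, x ∈ A i) ∧
        ∀ x ∈ l, ∀ y ∈ l, dist x y ≤ (1 - (k : ℝ)⁻¹) ^ r * D} := by
  induction r with
  | zero => simpa using hc
  | succ r ih =>
    rw [Function.iterate_succ_apply']
    refine mem_supported_of_single _ ?_ ih
    rintro l ⟨h1, ⟨i, h2⟩, h3⟩
    refine Finsupp.supported_mono ?_ (subdiv_single_mem_supported k le_rfl h1 h3 (hA i) h2)
    rintro l' ⟨h1, h2, h3⟩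
    exact ⟨h1, ⟨i, h2⟩, fun x hx y hy => (h3 x hx y hy).trans (by rw [pow_succ']; ring_nf; rfl)⟩

end Subdivision

end ListChain

namespace BorsukUlam

open ListChain

/-- The boundary of the cross-polytope in `ℝ^m`. -/
def octahedralSphere (m : ℕ) : Set (Fin m → ℝ) := {x | ∑ i, |x i| = 1}

/-- The facet of the cross-polytope lying in the orthant with signs `ε`. -/
def orthantFacet {m : ℕ} (ε : Fin m → ℤˣ) : Set (Fin m → ℝ) :=
  {x | (∀ i, 0 ≤ ((ε i : ℤ) : ℝ) * x i) ∧ ∑ i, ((ε i : ℤ) : ℝ) * x i = 1}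

lemma convex_orthantFacet {m : ℕ} (ε : Fin m → ℤˣ) : Convex ℝ (orthantFacet ε) := by
  rintro x ⟨hx, hx1⟩ y ⟨hy, hy1⟩ a b ha hb hab
  have h : ∀ i, ((ε i : ℤ) : ℝ) * (a • x + b • y) i
      = a * (((ε i : ℤ) : ℝ) * x i) + b * (((ε i : ℤ) : ℝ) * y i) := by
    intro i
    simp only [Pi.add_apply, Pi.smul_apply, smul_eq_mul]
    ring
  refine ⟨fun i => ?_, ?_⟩
  · rw [h]
    exact add_nonneg (mul_nonneg ha (hx i)) (mul_nonneg hb (hy i))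
  · simp only [h, Finset.sum_add_distrib, ← Finset.mul_sum, hx1, hy1]
    linarith

lemma orthantFacet_subset {m : ℕ} (ε : Fin m → ℤˣ) : orthantFacet ε ⊆ octahedralSphere m := by
  rintro x ⟨hx, hx1⟩
  rw [octahedralSphere, Set.mem_ofPred_eq, ← hx1]
  refine Finset.sum_congr rfl fun i _ => ?_
  rw [← abs_of_nonneg (hx i), abs_mul]
  rcases Int.units_eq_one_or (ε i) with h | h <;> simp [h]

lemma neg_mem_octahedralSphere {m : ℕ} {x : Fin m → ℝ} (hx : x ∈ octahedralSphere m) :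
    -x ∈ octahedralSphere m := by
  simpa [octahedralSphere] using hx

lemma norm_le_one_of_mem {m : ℕ} {x : Fin m → ℝ} (hx : x ∈ octahedralSphere m) : ‖x‖ ≤ 1 := by
  refine (pi_norm_le_iff_of_nonneg zero_le_one).2 fun i => ?_
  rw [Real.norm_eq_abs, ← Set.mem_ofPred_eq.mp hx]
  exact Finset.single_le_sum (f := fun i => |x i|) (fun i _ => abs_nonneg _) (Finset.mem_univ i)

lemma isCompact_octahedralSphere (m : ℕ) : IsCompact (octahedralSphere m) := by
  refine Metric.isCompact_of_isClosed_isBounded ?_ ?_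
  · exact isClosed_eq (by fun_prop) continuous_const
  · refine (Metric.isBounded_closedBall (x := 0) (r := 1)).subset fun x hx => ?_
    simpa using norm_le_one_of_mem hx

/-- The `k`-th coordinate vector, or zero if `m ≤ k`. -/
def coordVec (m k : ℕ) : Fin m → ℝ := fun i => if i.val = k then 1 else 0

/-- The `k`-dimensional hemisphere of the octahedral sphere, as a simplicial chain. -/
noncomputable def hemisphere (m : ℕ) : ℕ → (List (Fin m → ℝ) →₀ ZMod 2)
  | 0 => Finsupp.single [coordVec m 0] 1
  | k + 1 => cone (coordVec m (k + 1)) (hemisphere m k + map Neg.neg (hemisphere m k))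

lemma boundary_hemisphere_succ (m k : ℕ) :
    boundary (hemisphere m (k + 1)) = hemisphere m k + map Neg.neg (hemisphere m k) := by
  rw [hemisphere, boundary_cone]
  suffices h : boundary (hemisphere m k + map Neg.neg (hemisphere m k)) = 0 by
    rw [h, map_zero, add_zero]
  rw [map_add, boundary_map]
  induction k with
  | zero => simp [hemisphere, facets, ZModModule.add_self]
  | succ k ih =>
    have hinv : ∀ c : List (Fin m → ℝ) →₀ ZMod 2, map Neg.neg (map Neg.neg c) = c := by
      intro c
      suffices h : map Neg.neg ∘ₗ map Neg.neg =
          (LinearMap.id : (List (Fin m → ℝ) →₀ ZMod 2) →ₗ[ZMod 2] _) from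
        LinearMap.congr_fun h c
      ext1 l
      ext1
      simp
    rw [hemisphere, boundary_cone, map_add boundary, boundary_map, ih, map_zero, add_zero, map_add,
      hinv, add_comm (map Neg.neg _), ZModModule.add_self]

lemma hemisphere_mem_supported {m k : ℕ} (hk : k < m) :
    hemisphere m k ∈ Finsupp.supported (ZMod 2) (ZMod 2)
      {l | l.length ≤ k + 1 ∧ ∃ ε, ∀ x ∈ l, x ∈ orthantFacet ε ∧ ∀ i : Fin m, k < i → x i = 0} := by
  have hvec : ∀ (k : ℕ) (hk : k < m) (ε : Fin m → ℤˣ), ε ⟨k, hk⟩ = 1 →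
      coordVec m k ∈ orthantFacet ε := by
    intro k hk ε hε
    have h : ∀ i, ((ε i : ℤ) : ℝ) * coordVec m k i = if i = ⟨k, hk⟩ then 1 else 0 := by
      intro i
      by_cases hi : i = ⟨k, hk⟩
      · simp [hi, hε, coordVec]
      · have : i.val ≠ k := fun h => hi (Fin.ext h)
        simp [hi, coordVec, this]
    refine ⟨fun i => ?_, ?_⟩
    · rw [h]
      split_ifs <;> simp
    · simp [h]
  induction k with
  | zero =>
    refine Finsupp.single_mem_supported _ _ ⟨by simp, 1, ?_⟩
    simp only [List.mem_singleton, forall_eq]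
    refine ⟨hvec 0 hk 1 rfl, fun i hi => ?_⟩
    simp [coordVec, hi.ne']
  | succ k ih =>
    have h := ih (by omega)
    refine cone_mem_supported ?_ (add_mem h (map_mem_supported ?_ h))
    · rintro l ⟨hl, ε, hε⟩
      refine ⟨by simpa using hl, Function.update ε ⟨k + 1, hk⟩ 1, ?_⟩
      simp only [List.mem_cons, forall_eq_or_imp]
      refine ⟨⟨hvec _ hk _ (by simp), fun i hi => by simp [coordVec, hi.ne']⟩, fun x hx => ?_⟩
      obtain ⟨⟨h1, h2⟩, h3⟩ := hε x hx
      have h4 : ∀ i, ((Function.update ε ⟨k + 1, hk⟩ 1 i : ℤ) : ℝ) * x i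
          = ((ε i : ℤ) : ℝ) * x i := by
        intro i
        by_cases hi : i = ⟨k + 1, hk⟩
        · rw [h3 i (by simp [hi])]
          simp
        · rw [Function.update_of_ne hi]
      exact ⟨⟨fun i => by rw [h4]; exact h1 i, by simpa only [h4] using h2⟩,
        fun i hi => h3 i (by omega)⟩
    · rintro l ⟨hl, ε, hε⟩
      refine ⟨by simpa using hl, -ε, ?_⟩
      simp only [List.mem_map, forall_exists_index, and_imp, forall_apply_eq_imp_iff₂]
      intro x hx
      obtain ⟨⟨h1, h2⟩, h3⟩ := hε x hx
      refine ⟨⟨fun i => by simpa using h1 i, by simpa using h2⟩, fun i hi => by simp [h3 i hi]⟩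

/-- The `{0, 1}`-valued sign of an odd function `g`, made odd by breaking ties at its zeros. -/
noncomputable def oddSign {E : Type*} [Neg E] (g : E → ℝ) (x : E) : ZMod 2 :=
  open Classical in if 0 < g x ∨ g x = 0 ∧ WellOrderingRel x (-x) then 1 else 0

lemma oddSign_neg {E : Type*} [InvolutiveNeg E] {g : E → ℝ} {x : E} (hg : g (-x) = -g x)
    (hx : x ≠ -x) : oddSign g (-x) = oddSign g x + 1 := by
  have h2 : (1 + 1 : ZMod 2) = 0 := rfl
  rcases lt_trichotomy (g x) 0 with h | h | h
  · simp [oddSign, hg, h, h.not_gt, h.ne]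
  · rcases trichotomous_of WellOrderingRel x (-x) with h' | h' | h'
    · simp [oddSign, hg, h, h', asymm h', h2]
    · exact absurd h' hx
    · simp [oddSign, hg, h, h', asymm h']
  · simp [oddSign, hg, h, h.not_gt, h.ne', h2]

lemma nonpos_nonneg_of_oddSign_ne {E : Type*} [Neg E] {g : E → ℝ} {x y : E}
    (h : oddSign g x ≠ oddSign g y) : g x ≤ 0 ∧ 0 ≤ g y ∨ g y ≤ 0 ∧ 0 ≤ g x := by
  by_contra! hc
  rcases lt_or_ge 0 (g x) with hx | hx
  · have hy : 0 < g y := by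
      by_contra! hy
      exact absurd hx (hc.2 hy).not_gt
    simp [oddSign, hx, hy] at h
  · have hy := hc.1 hx
    have hx' := hc.2 hy.le
    simp [oddSign, hx'.not_gt, hy.not_gt, hx'.ne, hy.ne] at h

/-- **Borsuk–Ulam theorem** for the boundary of the cross-polytope. -/
theorem exists_eq_neg {m n : ℕ} (hnm : n < m) {f : (Fin m → ℝ) → (Fin n → ℝ)}
    (hf : ContinuousOn f (octahedralSphere m)) :
    ∃ x ∈ octahedralSphere m, f x = f (-x) := by
  set S := octahedralSphere m with hS
  by_contra! hne
  set F : (Fin m → ℝ) → (Fin n → ℝ) := fun x => f x - f (-x) with hF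
  have hFc : ContinuousOn F S :=
    hf.sub (hf.comp continuous_neg.continuousOn fun x hx => neg_mem_octahedralSphere hx)
  have hcpt : IsCompact S := isCompact_octahedralSphere m
  have hSne : S.Nonempty := by
    refine ⟨coordVec m 0, ?_⟩
    rw [hS, octahedralSphere, Set.mem_ofPred_eq,
      Finset.sum_eq_single_of_mem (⟨0, by omega⟩ : Fin m) (Finset.mem_univ _)]
    · simp [coordVec]
    · intro i _ hi
      have : i.val ≠ 0 := fun h => hi (Fin.ext h)
      simp [coordVec, this]
  obtain ⟨x₀, hx₀, hmin⟩ := hcpt.exists_isMinOn hSne hFc.norm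
  have hε : 0 < ‖F x₀‖ := norm_pos_iff.2 (sub_ne_zero.2 (hne x₀ hx₀))
  obtain ⟨δ, hδ, huc⟩ := Metric.uniformContinuousOn_iff.1
    (hcpt.uniformContinuousOn_of_continuous hFc) _ hε
  set q : ℝ := 1 - ((n + 1 : ℕ) : ℝ)⁻¹ with hq
  have hq0 : 0 ≤ q := by
    rw [hq, sub_nonneg]
    exact inv_le_one_of_one_le₀ (by simp)
  have hq1 : q < 1 := by
    rw [hq]
    have : (0 : ℝ) < ((n + 1 : ℕ) : ℝ)⁻¹ := by positivity
    linarith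
  obtain ⟨r, hr⟩ := exists_pow_lt_of_lt_one (half_pos hδ) hq1
  set s : ℕ → (Fin m → ℝ) → ZMod 2 :=
    fun i => oddSign fun x => if h : i < n then F x ⟨i, h⟩ else 0
  have hodd : ∀ i, ∀ x ∈ S, s i (-x) = s i x + 1 := by
    intro i x hx
    refine oddSign_neg ?_ fun h => hne x hx (congrArg f h)
    split_ifs <;> simp [hF]
  set H : ℕ → (List (Fin m → ℝ) →₀ ZMod 2) :=
    fun k => (subdiv (k + 1))^[r] (hemisphere m k) with hH
  have hsupp : ∀ k < m, H k ∈ Finsupp.supported (ZMod 2) (ZMod 2)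
      {l | l.length ≤ k + 1 ∧ (∃ ε, ∀ x ∈ l, x ∈ orthantFacet ε) ∧
        ∀ x ∈ l, ∀ y ∈ l, dist x y ≤ (1 - ((k + 1 : ℕ) : ℝ)⁻¹) ^ r * 2} := by
    intro k hk
    refine subdiv_iterate_mem_supported convex_orthantFacet _ r
      (Finsupp.supported_mono ?_ (hemisphere_mem_supported hk))
    rintro l ⟨h1, ε, h2⟩
    refine ⟨h1, ⟨ε, fun x hx => (h2 x hx).1⟩, fun x hx y hy => ?_⟩
    rw [dist_eq_norm]
    have hx' := norm_le_one_of_mem (orthantFacet_subset ε (h2 x hx).1)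
    have hy' := norm_le_one_of_mem (orthantFacet_subset ε (h2 y hy).1)
    linarith [norm_sub_le x y]
  have hone : eval (cupCoboundary s n) (H n) = 1 := by
    refine eval_cupCoboundary_eq_one (T := Neg.neg) s
      (subdiv_iterate_single_singleton r (coordVec m 0)) n ?_ ?_
    · intro k _
      simp only [hH]
      rw [boundary_subdiv_iterate, boundary_hemisphere_succ, ← subdiv_iterate_map_neg,
        iterate_map_add]
    · intro k hk
      refine Finsupp.supported_mono ?_ (hsupp k (hk.trans hnm))
      rintro l ⟨-, ⟨ε, h⟩, -⟩ i x hx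
      exact hodd i x (orthantFacet_subset ε (h x hx))
  obtain ⟨l, hl, hl0⟩ : ∃ l ∈ (H n).support, cupCoboundary s n l ≠ 0 := by
    by_contra! hc
    rw [eval, Finsupp.linearCombination_apply, Finsupp.sum,
      Finset.sum_eq_zero fun l hl => by rw [hc l hl, smul_zero]] at hone
    exact zero_ne_one hone
  obtain ⟨-, ⟨ε, hlε⟩, hdist⟩ := (Finsupp.mem_supported _ _).1 (hsupp n hnm) hl
  have hlS : ∀ x ∈ l, x ∈ S := fun x hx => orthantFacet_subset ε (hlε x hx)
  have hclose : ∀ x ∈ l, ∀ y ∈ l, dist (F x) (F y) < ‖F x₀‖ := fun x hx y hy =>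
    huc x (hlS x hx) y (hlS y hy) ((hdist x hx y hy).trans_lt (by linarith))
  obtain ⟨x, hx⟩ : ∃ x, x ∈ l := by
    refine List.exists_mem_of_ne_nil l ?_
    rintro rfl
    exact hl0 (cupCoboundary_nil s n)
  refine (hmin (hlS x hx)).not_gt ((pi_norm_lt_iff hε).2 fun i => ?_)
  obtain ⟨a, ha, b, hb, hab⟩ := exists_ne_of_cupCoboundary_ne_zero s n l hl0 i i.2
  have h1 := abs_lt.1 (((dist_pi_lt_iff hε).1 (hclose x hx a ha)) i)
  have h2 := abs_lt.1 (((dist_pi_lt_iff hε).1 (hclose x hx b hb)) i)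
  rw [Real.norm_eq_abs, abs_lt]
  have h3 := nonpos_nonneg_of_oddSign_ne hab
  simp only [i.2, dif_pos, Fin.eta] at h3
  rcases h3 with ⟨h3, h4⟩ | ⟨h3, h4⟩ <;> constructor <;> linarith [h1.1, h1.2, h2.1, h2.2]

end BorsukUlam

lemma collapsible_of_isCone {V : Type} [DecidableEq V] (C : SimplicialCx V) (v : V)
    (hv : {v} ∈ C.faces) (hcone : ∀ σ ∈ C.faces, insert v σ ∈ C.faces) : Collapsible C := by
  induction hN : C.faces.card using Nat.strong_induction_on generalizing C with
  | _ N ih =>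
    by_cases hbase : ∃ σ ∈ C.faces, v ∉ σ
    · have hne : (C.faces.filter (v ∉ ·)).Nonempty := by
        obtain ⟨σ, hσ, hvσ⟩ := hbase
        exact ⟨σ, Finset.mem_filter.2 ⟨hσ, hvσ⟩⟩
      obtain ⟨σ, hσ, hmax⟩ := Finset.exists_max_image _ Finset.card hne
      obtain ⟨hσC, hvσ⟩ := Finset.mem_filter.1 hσ
      have hfree : ∀ τ ∈ C.faces, σ ⊂ τ → τ = insert v σ := by
        intro τ hτ hστ
        by_cases hvτ : v ∈ τ
        · have hsub : σ ⊆ τ.erase v := fun x hx =>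
            Finset.mem_erase.2 ⟨fun h => hvσ (h ▸ hx), hστ.subset hx⟩
          have hmem : τ.erase v ∈ C.faces :=
            C.down_closed τ hτ _ (Finset.erase_subset _ _) ((C.nonempty_of_mem σ hσC).mono hsub)
          have := Finset.eq_of_subset_of_card_le hsub
            (hmax _ (Finset.mem_filter.2 ⟨hmem, Finset.notMem_erase v τ⟩))
          rw [this, Finset.insert_erase hvτ]
        · exact absurd (Finset.card_lt_card hστ)
            (hmax τ (Finset.mem_filter.2 ⟨hτ, hvτ⟩)).not_gt
      have hσne := C.nonempty_of_mem σ hσC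
      have hssub : σ ⊂ insert v σ := Finset.ssubset_insert hvσ
      let C' : SimplicialCx V :=
        { faces := C.faces \ {σ, insert v σ}
          nonempty_of_mem := fun τ hτ => C.nonempty_of_mem τ (Finset.mem_sdiff.1 hτ).1
          down_closed := by
            intro ρ hρ τ hτρ hτ
            simp only [Finset.mem_sdiff, Finset.mem_insert, Finset.mem_singleton, not_or] at hρ ⊢
            obtain ⟨hρC, hρ1, hρ2⟩ := hρ
            refine ⟨C.down_closed ρ hρC τ hτρ hτ, ?_, ?_⟩
            · rintro rfl
              exact hρ2 (hfree ρ hρC (hτρ.ssubset_of_ne (Ne.symm hρ1)))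
            · rintro rfl
              exact hρ2 (hfree ρ hρC (hssub.trans_subset hτρ)) }
      have hcollapse : IsElementaryCollapse C C' :=
        ⟨σ, insert v σ, hσC, hcone σ hσC, hssub, Finset.card_insert_of_notMem hvσ, hfree, rfl⟩
      have hcard : C'.faces.card < N := by
        rw [← hN]
        refine Finset.card_lt_card ⟨Finset.sdiff_subset, fun h => ?_⟩
        simpa using (Finset.mem_sdiff.1 (h hσC)).2
      suffices h : {v} ∈ C'.faces ∧ ∀ τ ∈ C'.faces, insert v τ ∈ C'.faces by
        obtain ⟨D, hD, hpt⟩ := ih _ hcard C' h.1 h.2 rfl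
        exact ⟨D, Relation.ReflTransGen.head hcollapse hD, hpt⟩
      constructor
      · simp only [C', Finset.mem_sdiff, Finset.mem_insert, Finset.mem_singleton, not_or]
        refine ⟨hv, ?_, fun h => ?_⟩
        · exact fun h => hvσ (h ▸ Finset.mem_singleton_self v)
        · obtain ⟨x, hx⟩ := hσne
          have : x ∈ ({v} : Finset V) := h ▸ Finset.mem_insert_of_mem hx
          exact hvσ (Finset.mem_singleton.1 this ▸ hx)
      · intro τ hτ
        simp only [C', Finset.mem_sdiff, Finset.mem_insert, Finset.mem_singleton, not_or] at hτ ⊢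
        obtain ⟨hτC, hτ1, hτ2⟩ := hτ
        refine ⟨hcone τ hτC, fun h => hvσ (h ▸ Finset.mem_insert_self v τ), fun h => ?_⟩
        by_cases hvτ : v ∈ τ
        · exact hτ2 (by rw [← h, Finset.insert_eq_of_mem hvτ])
        · exact hτ1 (by rw [← Finset.erase_insert hvτ, h, Finset.erase_insert hvσ])
    · push Not at hbase
      refine ⟨C, Relation.ReflTransGen.refl, v, Finset.eq_singleton_iff_unique_mem.2
        ⟨hv, fun σ hσ => Finset.eq_singleton_iff_unique_mem.2 ⟨hbase σ hσ, fun x hx => ?_⟩⟩⟩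
      have := hbase {x} (C.down_closed σ hσ {x} (by simpa using hx) (by simp))
      exact (Finset.mem_singleton.1 this).symm

/-- The cone over the `d`-fold join of three points: vertex `3 * d` is the apex, and the vertices
`3 * i`, `3 * i + 1`, `3 * i + 2` with `i < d` form the `i`-th triple. -/
def coneJoinThreePoints (d : ℕ) : SimplicialCx (Fin (3 * d + 1)) where
  faces := Finset.univ.filter fun σ => σ.Nonempty ∧ ∀ a ∈ σ, ∀ b ∈ σ, a.val / 3 = b.val / 3 → a = b
  nonempty_of_mem _ hσ := (Finset.mem_filter.1 hσ).2.1
  down_closed _ hσ _ hτσ hτ := Finset.mem_filter.2 ⟨Finset.mem_univ _, hτ, fun a ha b hb =>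
    (Finset.mem_filter.1 hσ).2.2 a (hτσ ha) b (hτσ hb)⟩

lemma mem_faces_coneJoinThreePoints {d : ℕ} {σ : Finset (Fin (3 * d + 1))} :
    σ ∈ (coneJoinThreePoints d).faces ↔
      σ.Nonempty ∧ ∀ a ∈ σ, ∀ b ∈ σ, a.val / 3 = b.val / 3 → a = b := by
  simp [coneJoinThreePoints]

lemma collapsible_coneJoinThreePoints (d : ℕ) : Collapsible (coneJoinThreePoints d) := by
  have hlast : ∀ a : Fin (3 * d + 1), a.val / 3 = d → a = Fin.last (3 * d) := by
    intro a ha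
    ext
    simp only [Fin.val_last]
    omega
  refine collapsible_of_isCone _ (Fin.last (3 * d)) ?_ fun σ hσ => ?_
  · rw [mem_faces_coneJoinThreePoints]
    simp
  · rw [mem_faces_coneJoinThreePoints] at hσ ⊢
    refine ⟨Finset.insert_nonempty _ _, fun a ha b hb hab => ?_⟩
    have hd : 3 * d / 3 = d := by omega
    rcases Finset.mem_insert.1 ha with rfl | ha <;> rcases Finset.mem_insert.1 hb with rfl | hb
    · rfl
    · exact (hlast b (by rw [← hab, Fin.val_last, hd])).symm
    · exact hlast a (by rw [hab, Fin.val_last, hd])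
    · exact hσ.2 a ha b hb hab

lemma card_le_of_mem_coneJoinThreePoints {d : ℕ} {σ : Finset (Fin (3 * d + 1))}
    (hσ : σ ∈ (coneJoinThreePoints d).faces) : σ.card ≤ d + 1 := by
  rw [mem_faces_coneJoinThreePoints] at hσ
  rw [← Finset.card_range (d + 1)]
  refine Finset.card_le_card_of_injOn (fun a => a.val / 3) (fun a _ => ?_)
    fun a ha b hb hab => hσ.2 a ha b hb hab
  simp only [Finset.coe_range, Set.mem_Iio]
  omega

lemma exists_card_eq_coneJoinThreePoints (d : ℕ) :
    ∃ σ ∈ (coneJoinThreePoints d).faces, σ.card = d + 1 := by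
  refine ⟨Finset.univ.image fun i : Fin (d + 1) => (⟨3 * i, by omega⟩ : Fin (3 * d + 1)), ?_, ?_⟩
  · rw [mem_faces_coneJoinThreePoints]
    refine ⟨by simp, ?_⟩
    simp only [Finset.mem_image, Finset.mem_univ, true_and, forall_exists_index,
      forall_apply_eq_imp_iff, Fin.mk.injEq]
    intro i j h
    omega
  · rw [Finset.card_image_of_injective, Finset.card_univ, Fintype.card_fin]
    intro i j h
    simp only [Fin.mk.injEq] at h
    ext
    omega

/-- The coordinates of a piecewise linear map from the plane to the tripod which does not identify
any two antipodal points. -/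
noncomputable def tripod (k : ℕ) (x y : ℝ) : ℝ :=
  max 0 (if k = 0 then min x y else if k = 1 then min (-x) (y - x) else min (-y) (x - y))

lemma tripod_nonneg (k : ℕ) (x y : ℝ) : 0 ≤ tripod k x y := le_max_left _ _

lemma continuous_tripod (k : ℕ) : Continuous fun p : ℝ × ℝ => tripod k p.1 p.2 := by
  unfold tripod
  split_ifs <;> fun_prop

lemma tripod_pos_iff (k : ℕ) (x y : ℝ) : 0 < tripod k x y ↔
    if k = 0 then 0 < x ∧ 0 < y else if k = 1 then x < 0 ∧ x < y else y < 0 ∧ y < x := by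
  unfold tripod
  split_ifs <;> simp

lemma eq_of_tripod_ne_zero {k l : ℕ} (hk : k < 3) (hl : l < 3) {x y : ℝ}
    (h1 : tripod k x y ≠ 0) (h2 : tripod l x y ≠ 0) : k = l := by
  have h1 := (tripod_pos_iff k x y).1 ((tripod_nonneg k x y).lt_of_ne' h1)
  have h2 := (tripod_pos_iff l x y).1 ((tripod_nonneg l x y).lt_of_ne' h2)
  interval_cases k <;> interval_cases l <;> simp at h1 h2 ⊢ <;> linarith [h1.1, h1.2, h2.1, h2.2]

lemma tripod_sum_le (x y : ℝ) : tripod 0 x y + tripod 1 x y + tripod 2 x y ≤ |x| + |y| := by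
  simp only [tripod, if_true, one_ne_zero, OfNat.ofNat_ne_zero, OfNat.ofNat_ne_one, if_false,
    max_def, min_def]
  split_ifs <;> linarith [le_abs_self x, neg_le_abs x, le_abs_self y, neg_le_abs y]

lemma eq_zero_of_tripod_eq_neg {x y : ℝ} (h : ∀ k < 3, tripod k x y = tripod k (-x) (-y)) :
    x = 0 ∧ y = 0 := by
  have h' : ∀ k < 3, (0 < tripod k x y ↔ 0 < tripod k (-x) (-y)) := fun k hk => by rw [h k hk]
  have h0 := h' 0 (by norm_num)
  have h1 := h' 1 (by norm_num)
  have h2 := h' 2 (by norm_num)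
  simp only [tripod_pos_iff] at h0 h1 h2
  norm_num at h0 h1 h2
  rcases lt_trichotomy x 0 with hx | hx | hx <;> rcases lt_trichotomy y 0 with hy | hy | hy <;>
    rcases lt_trichotomy x y with hxy | hxy | hxy <;> grind

open BorsukUlam

/-- The coordinates of a point of `ℝ^(2 * d)`, extended by zero. The `i`-th plane has coordinates
`2 * i` and `2 * i + 1`. -/
def planeCoord {d : ℕ} (x : Fin (2 * d) → ℝ) (j : ℕ) : ℝ := if h : j < 2 * d then x ⟨j, h⟩ else 0

/-- The coordinates of the product of `d` copies of the tripod map. -/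
noncomputable def tripodCoord {d : ℕ} (x : Fin (2 * d) → ℝ) (j : ℕ) : ℝ :=
  tripod (j % 3) (planeCoord x (2 * (j / 3))) (planeCoord x (2 * (j / 3) + 1))

lemma continuous_tripodCoord {d : ℕ} (j : ℕ) :
    Continuous fun x : Fin (2 * d) → ℝ => tripodCoord x j := by
  have h : ∀ j, Continuous fun x : Fin (2 * d) → ℝ => planeCoord x j := by
    intro j
    unfold planeCoord
    split_ifs <;> fun_prop
  exact (continuous_tripod (j % 3)).comp ((h _).prodMk (h _))

lemma sum_tripodCoord_le {d : ℕ} {x : Fin (2 * d) → ℝ} (hx : x ∈ octahedralSphere (2 * d)) :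
    ∑ j ∈ Finset.range (3 * d), tripodCoord x j ≤ 1 := by
  have h1 : ∀ e, ∑ j ∈ Finset.range (3 * e), tripodCoord x j
      ≤ ∑ j ∈ Finset.range (2 * e), |planeCoord x j| := by
    intro e
    induction e with
    | zero => simp
    | succ e ih =>
      rw [show 3 * (e + 1) = 3 * e + 1 + 1 + 1 by ring, show 2 * (e + 1) = 2 * e + 1 + 1 by ring]
      simp only [Finset.sum_range_succ]
      have := tripod_sum_le (planeCoord x (2 * e)) (planeCoord x (2 * e + 1))
      simp only [tripodCoord] at ih ⊢
      rw [show 3 * e / 3 = e by omega, show (3 * e + 1) / 3 = e by omega,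
        show (3 * e + 1 + 1) / 3 = e by omega, show 3 * e % 3 = 0 by omega,
        show (3 * e + 1) % 3 = 1 by omega, show (3 * e + 1 + 1) % 3 = 2 by omega]
      linarith
  refine (h1 d).trans_eq ?_
  rw [Finset.sum_range, ← Set.mem_ofPred_eq.mp hx]
  exact Finset.sum_congr rfl fun i _ => by simp [planeCoord]

/-- The map from the octahedral sphere to the realization of the cone, in barycentric
coordinates. -/
noncomputable def tripodPoint {d : ℕ} (x : Fin (2 * d) → ℝ) : Fin (3 * d + 1) → ℝ :=
  Fin.snoc (α := fun _ => ℝ) (fun j : Fin (3 * d) => tripodCoord x j)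
    (1 - ∑ j ∈ Finset.range (3 * d), tripodCoord x j)

lemma tripodPoint_of_lt {d : ℕ} (x : Fin (2 * d) → ℝ) (j : Fin (3 * d + 1)) (hj : j.val < 3 * d) :
    tripodPoint x j = tripodCoord x j := by
  simp [tripodPoint, Fin.snoc, hj]

lemma sum_tripodPoint {d : ℕ} (x : Fin (2 * d) → ℝ) : ∑ j, tripodPoint x j = 1 := by
  rw [Fin.sum_univ_castSucc]
  simp [tripodPoint, Finset.sum_range]

lemma tripodPoint_mem_realization {d : ℕ} {x : Fin (2 * d) → ℝ}
    (hx : x ∈ octahedralSphere (2 * d)) : tripodPoint x ∈ realization (coneJoinThreePoints d) := by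
  classical
  refine ⟨Finset.univ.filter (tripodPoint x · ≠ 0), ?_, fun j => ?_, ?_, ?_⟩
  · rw [mem_faces_coneJoinThreePoints]
    refine ⟨?_, fun a ha b hb hab => ?_⟩
    · by_contra hne
      have := sum_tripodPoint x
      rw [Finset.not_nonempty_iff_eq_empty, Finset.filter_eq_empty_iff] at hne
      rw [Finset.sum_eq_zero fun j hj => not_not.1 (hne hj)] at this
      exact zero_ne_one this
    · have ha := (Finset.mem_filter.1 ha).2
      have hb := (Finset.mem_filter.1 hb).2
      ext
      rcases lt_or_ge a.val (3 * d) with ha' | ha'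
      · rw [tripodPoint_of_lt x a ha'] at ha
        rw [tripodPoint_of_lt x b (by omega)] at hb
        rw [tripodCoord] at ha hb
        rw [← hab] at hb
        have := eq_of_tripod_ne_zero (Nat.mod_lt _ (by norm_num)) (Nat.mod_lt _ (by norm_num)) ha hb
        omega
      · omega
  · refine Fin.lastCases ?_ (fun j => ?_) j
    · simpa [tripodPoint] using sum_tripodCoord_le hx
    · simp [tripodPoint, tripodCoord, tripod_nonneg]
  · intro j hj
    simpa using hj
  · rw [Finset.sum_filter_ne_zero, sum_tripodPoint]

lemma continuous_tripodPoint {d : ℕ} :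
    Continuous (tripodPoint : (Fin (2 * d) → ℝ) → Fin (3 * d + 1) → ℝ) := by
  refine continuous_pi fun j => ?_
  refine Fin.lastCases ?_ (fun j => ?_) j
  · simp only [tripodPoint, Fin.snoc_last]
    exact continuous_const.sub (continuous_finsetSum _ fun j _ => continuous_tripodCoord j)
  · simpa [tripodPoint] using continuous_tripodCoord j.val

lemma tripodPoint_ne_neg {d : ℕ} {x : Fin (2 * d) → ℝ} (hx : x ∈ octahedralSphere (2 * d)) :
    tripodPoint x ≠ tripodPoint (-x) := by
  intro h
  have hneg : ∀ j, planeCoord (-x) j = -planeCoord x j := by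
    intro j
    unfold planeCoord
    split_ifs <;> simp
  have hzero : ∀ i < d, planeCoord x (2 * i) = 0 ∧ planeCoord x (2 * i + 1) = 0 := by
    intro i hi
    refine eq_zero_of_tripod_eq_neg fun k hk => ?_
    have := congrFun h ⟨3 * i + k, by omega⟩
    rw [tripodPoint_of_lt _ _ (by simp only; omega), tripodPoint_of_lt _ _ (by simp only; omega)]
      at this
    simp only [tripodCoord] at this
    rwa [show (3 * i + k) / 3 = i by omega, show (3 * i + k) % 3 = k by omega, hneg, hneg] at this
  have hx0 : ∀ i, x i = 0 := by
    intro i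
    have hi : planeCoord x i = x i := by simp [planeCoord]
    obtain ⟨h1, h2⟩ := hzero (i.val / 2) (by omega)
    rw [← hi]
    rcases Nat.even_or_odd' i.val with ⟨c, hc | hc⟩
    · rwa [show 2 * (i.val / 2) = i.val by omega] at h1
    · rwa [show 2 * (i.val / 2) + 1 = i.val by omega] at h2
  simp [octahedralSphere, hx0] at hx

lemma not_topologicallyEmbeds_coneJoinThreePoints {d : ℕ} (hd : 1 ≤ d) :
    ¬ TopologicallyEmbeds (coneJoinThreePoints d) (2 * d - 1) := by
  classical
  rintro ⟨f, hf⟩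
  let g : (Fin (2 * d) → ℝ) → Fin (2 * d - 1) → ℝ := fun x =>
    if hx : x ∈ octahedralSphere (2 * d) then
      WithLp.ofLp (f ⟨tripodPoint x, tripodPoint_mem_realization hx⟩) else 0
  have hg : ContinuousOn g (octahedralSphere (2 * d)) := by
    rw [continuousOn_iff_continuous_domRestrict]
    have : (octahedralSphere (2 * d)).domRestrict g = fun x =>
        WithLp.ofLp (f ⟨tripodPoint x.1, tripodPoint_mem_realization x.2⟩) := by
      ext1 x
      simp [g]
    rw [this]
    exact (PiLp.continuous_ofLp 2 _).comp (hf.continuous.comp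
      ((continuous_tripodPoint.comp continuous_subtype_val).subtype_mk _))
  obtain ⟨x, hx, hgx⟩ := exists_eq_neg (by omega) hg
  simp only [g, hx, neg_mem_octahedralSphere hx, dif_pos] at hgx
  exact tripodPoint_ne_neg hx
    (congrArg Subtype.val (hf.injective (WithLp.ofLp_injective 2 hgx)))

/-- For every `d ≥ 2` there is a collapsible (hence contractible) `d`-dimensional
simplicial complex that does not topologically embed in `ℝ^(2d−1)`. -/
theorem exists_collapsible_not_embeddable (d : ℕ) (hd : 2 ≤ d) :
    ∃ (n : ℕ) (C : SimplicialCx (Fin n)),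
      Collapsible C ∧
      (∀ σ ∈ C.faces, σ.card ≤ d + 1) ∧
      (∃ σ ∈ C.faces, σ.card = d + 1) ∧
      ¬ TopologicallyEmbeds C (2 * d - 1) :=
  ⟨3 * d + 1, coneJoinThreePoints d, collapsible_coneJoinThreePoints d,
    fun _ => card_le_of_mem_coneJoinThreePoints, exists_card_eq_coneJoinThreePoints d,
    not_topologicallyEmbeds_coneJoinThreePoints (by omega)⟩
end

section
/- The real projective plane ℝP² admits a discrete Morse function with exactly one critical cell in each of dimensions 0, 1, 2 (i.e., Morse vector (1,1,1)), yet ℝP² is not contractible. Hence a 2-complex with Morse vector (1,1,1) need not be contractible. -/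
variable {V : Type} [DecidableEq V]

/-- `F` is a facet (maximal face) of `C`. -/
def IsFacet {V : Type} [DecidableEq V] (C : SimplicialCx V) (F : Finset V) : Prop :=
  F ∈ C.faces ∧ ∀ G ∈ C.faces, F ⊆ G → G = F

/-- `D` is the deletion `C − T`: the subcomplex of `C` generated by all facets
other than `T`. -/
def IsDeletionOf {V : Type} [DecidableEq V]
    (D C : SimplicialCx V) (T : Finset V) : Prop :=
  ∀ σ : Finset V, σ ∈ D.faces ↔
    (σ.Nonempty ∧ ∃ F : Finset V, IsFacet C F ∧ F ≠ T ∧ σ ⊆ F)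

/-- `A` is a closed polygonal arc (simplicial circle): its faces are the vertices
and consecutive edges of an injective cyclic sequence of `n ≥ 3` vertices. -/
def IsCycleComplex {V : Type} [DecidableEq V] (A : SimplicialCx V) : Prop :=
  ∃ n : ℕ, 3 ≤ n ∧ ∃ e : Fin n → V, Function.Injective e ∧
    ∀ σ : Finset V, σ ∈ A.faces ↔
      ((∃ i, σ = {e i}) ∨ (∃ i, σ = {e i, e (finRotate n i)}))

/-- A `2`-complex `C` has (discrete) Morse vector `(1,1,1)` if for some triangle
`T` of `C` the deletion `C − T` collapses onto a closed polygonal arc. -/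
def HasMorseVector111 {V : Type} [DecidableEq V] (C : SimplicialCx V) : Prop :=
  ∃ T ∈ C.faces, T.card = 3 ∧
    ∃ D : SimplicialCx V, IsDeletionOf D C T ∧
      ∃ A : SimplicialCx V, Relation.ReflTransGen IsElementaryCollapse D A ∧
        IsCycleComplex A

/-- The real projective plane, as the quotient of the unit sphere in ℝ³ by the
antipodal identification. -/
noncomputable def RP2 : Type :=
  Quot (fun x y : Metric.sphere (0 : EuclideanSpace ℝ (Fin 3)) 1 =>
    (x : EuclideanSpace ℝ (Fin 3)) = y ∨ (x : EuclideanSpace ℝ (Fin 3)) = -y)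

noncomputable instance : TopologicalSpace RP2 := by unfold RP2; infer_instance

namespace HemiIcosahedron

/-- Signs of the pairwise inner products of the six axes `axisVec`. -/
def edgeSign : Fin 6 → Fin 6 → ℤ :=
  ![![1, 1, 1, 1, 1, -1], ![1, 1, -1, -1, 1, -1], ![1, -1, 1, 1, 1, 1],
    ![1, -1, 1, 1, -1, -1], ![1, 1, 1, -1, 1, 1], ![-1, -1, 1, -1, 1, 1]]

/-- A set of axes is coherent if they can be oriented so that all pairwise inner products are
positive. -/
def Coherent (σ : Finset (Fin 6)) : Prop :=
  ∀ i ∈ σ, ∀ j ∈ σ, ∀ k ∈ σ, edgeSign i j * edgeSign i k = edgeSign j k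

instance : DecidablePred Coherent := fun σ => by unfold Coherent; infer_instance

/-- The six-vertex projective plane: its faces are the nonempty coherent sets of axes. -/
def complex : SimplicialCx (Fin 6) where
  faces := Finset.univ.filter fun σ => σ.Nonempty ∧ Coherent σ
  nonempty_of_mem σ h := (Finset.mem_filter.1 h).2.1
  down_closed σ h τ hτ hne := by
    simp only [Finset.mem_filter, Finset.mem_univ, true_and] at h ⊢
    exact ⟨hne, fun i hi j hj k hk => h.2 i (hτ hi) j (hτ hj) k (hτ hk)⟩

lemma mem_complex {σ : Finset (Fin 6)} : σ ∈ complex.faces ↔ σ.Nonempty ∧ Coherent σ := by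
  simp [complex]

/-- The list of the ten triangles. -/
def facets : List (Finset (Fin 6)) :=
  [{0, 1, 4}, {0, 1, 5}, {2, 3, 0}, {2, 3, 1}, {4, 5, 2}, {4, 5, 3}, {0, 2, 4}, {0, 3, 5},
    {1, 3, 4}, {1, 2, 5}]

lemma coherent_iff_exists_facet (σ : Finset (Fin 6)) : Coherent σ ↔ ∃ F ∈ facets, σ ⊆ F := by
  revert σ
  decide +kernel

/-- The pair `p` of faces is free in the family `F`. -/
def IsFreePair (F : Finset (Finset V)) (p : Finset V × Finset V) : Prop :=
  p.1 ∈ F ∧ p.2 ∈ F ∧ p.1 ⊂ p.2 ∧ p.2.card = p.1.card + 1 ∧ ∀ τ ∈ F, p.1 ⊂ τ → τ = p.2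

instance (F : Finset (Finset V)) (p : Finset V × Finset V) : Decidable (IsFreePair F p) := by
  unfold IsFreePair; infer_instance

/-- Removing a free pair from a complex leaves a complex. -/
def eraseFreePair (C : SimplicialCx V) (p : Finset V × Finset V) (h : IsFreePair C.faces p) :
    SimplicialCx V where
  faces := C.faces \ {p.1, p.2}
  nonempty_of_mem σ hσ := C.nonempty_of_mem σ (Finset.mem_sdiff.1 hσ).1
  down_closed σ hσ τ hτ hne := by
    obtain ⟨-, -, hp, -, hfree⟩ := h
    simp only [Finset.mem_sdiff, Finset.mem_insert, Finset.mem_singleton, not_or] at hσ ⊢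
    refine ⟨C.down_closed σ hσ.1 τ hτ hne, ?_, ?_⟩
    · rintro rfl
      exact hσ.2.2 (hfree σ hσ.1 (hτ.ssubset_of_ne (Ne.symm hσ.2.1)))
    · rintro rfl
      exact hσ.2.2 (hfree σ hσ.1 (hp.trans_subset hτ))

/-- The pairs in the list are successively free, starting from the family `F`. -/
def FreePairs : Finset (Finset V) → List (Finset V × Finset V) → Prop
  | _, [] => True
  | F, p :: L => IsFreePair F p ∧ FreePairs (F \ {p.1, p.2}) L

instance decidableFreePairs :
    (F : Finset (Finset V)) → (L : List (Finset V × Finset V)) → Decidable (FreePairs F L)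
  | _, [] => isTrue trivial
  | F, p :: L =>
    have := decidableFreePairs (F \ {p.1, p.2}) L
    inferInstanceAs (Decidable (IsFreePair F p ∧ FreePairs (F \ {p.1, p.2}) L))

lemma exists_collapse (L : List (Finset V × Finset V)) (D : SimplicialCx V)
    (h : FreePairs D.faces L) :
    ∃ A : SimplicialCx V, Relation.ReflTransGen IsElementaryCollapse D A ∧
      A.faces = L.foldl (fun F p => F \ {p.1, p.2}) D.faces := by
  induction L generalizing D with
  | nil => exact ⟨D, .refl, rfl⟩
  | cons p L ih =>
    obtain ⟨hp, hL⟩ := h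
    obtain ⟨A, hA, hfaces⟩ := ih (eraseFreePair D p hp) hL
    refine ⟨A, .head ⟨p.1, p.2, ?_⟩ hA, hfaces⟩
    exact ⟨hp.1, hp.2.1, hp.2.2.1, hp.2.2.2.1, hp.2.2.2.2, rfl⟩

/-- The complex with the triangle `{0, 1, 4}` removed. -/
def punctured : SimplicialCx (Fin 6) where
  faces := complex.faces.erase {0, 1, 4}
  nonempty_of_mem σ h := complex.nonempty_of_mem σ (Finset.mem_of_mem_erase h)
  down_closed := by
    have h : ∀ σ ∈ complex.faces, {0, 1, 4} ⊆ σ → σ = {0, 1, 4} := by decide +kernel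
    intro σ hσ τ hτ hne
    rw [Finset.mem_erase] at hσ ⊢
    refine ⟨?_, complex.down_closed σ hσ.2 τ hτ hne⟩
    rintro rfl
    exact hσ.1 (h σ hσ.2 hτ)

lemma isFacet_iff (F : Finset (Fin 6)) : IsFacet complex F ↔ F ∈ facets := by
  revert F
  unfold IsFacet
  decide +kernel

/-- A collapse of the punctured complex onto the circle `2, 3, 5`. -/
def collapsePairs : List (Finset (Fin 6) × Finset (Fin 6)) :=
  [({0, 1}, {0, 1, 5}), ({0, 4}, {0, 2, 4}), ({0, 2}, {0, 2, 3}), ({0, 3}, {0, 3, 5}),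
    ({1, 4}, {1, 3, 4}), ({1, 3}, {1, 2, 3}), ({1, 2}, {1, 2, 5}), ({2, 4}, {2, 4, 5}),
    ({3, 4}, {3, 4, 5}), ({0}, {0, 5}), ({1}, {1, 5}), ({4}, {4, 5})]

lemma hasMorseVector111 : HasMorseVector111 complex := by
  refine ⟨{0, 1, 4}, by decide +kernel, rfl, punctured, ?_, ?_⟩
  · intro σ
    simp only [isFacet_iff]
    revert σ
    decide +kernel
  · obtain ⟨A, hA, hfaces⟩ := exists_collapse collapsePairs punctured (by decide +kernel)
    refine ⟨A, hA, 3, le_rfl, ![2, 3, 5], by decide, ?_⟩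
    rw [hfaces]
    decide +kernel

/-- The piecewise linear coordinate of the axis `(1, 1, 0)`, before symmetrization. -/
noncomputable def hat (x y z : ℝ) : ℝ := max 0 (min ((x + y - |z|) / 2) x)

/-- The even piecewise linear coordinate of the axis `(1, 1, 0)`. -/
noncomputable def evenHat (x y z : ℝ) : ℝ := hat x y z + hat (-x) (-y) z

/-- The barycentric coordinates, up to scale, of a point with respect to the six axes. -/
noncomputable def weights (x : Fin 3 → ℝ) : Fin 6 → ℝ :=
  ![evenHat (x 0) (x 1) (x 2), evenHat (x 0) (-x 1) (x 2),
    evenHat (x 1) (x 2) (x 0), evenHat (x 1) (-x 2) (x 0),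
    evenHat (x 2) (x 0) (x 1), evenHat (x 2) (-x 0) (x 1)]

/-- Direction vectors of the six axes. -/
def axisVec : Fin 6 → Fin 3 → ℝ :=
  ![![1, 1, 0], ![1, -1, 0], ![0, 1, 1], ![0, 1, -1], ![1, 0, 1], ![-1, 0, 1]]

/-- The combination with weights `w` of the axes, oriented coherently with the axis `b`. -/
def point (b : Fin 6) (w : Fin 6 → ℝ) : Fin 3 → ℝ := ∑ i, ((edgeSign b i : ℝ) * w i) • axisVec i

lemma hat_nonneg (x y z : ℝ) : 0 ≤ hat x y z := le_max_left _ _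

lemma evenHat_neg (x y z : ℝ) : evenHat (-x) (-y) (-z) = evenHat x y z := by
  simp [evenHat, hat, add_comm]

lemma weights_nonneg (x : Fin 3 → ℝ) (i : Fin 6) : 0 ≤ weights x i := by
  have h (x y z : ℝ) : 0 ≤ evenHat x y z := add_nonneg (hat_nonneg _ _ _) (hat_nonneg _ _ _)
  fin_cases i <;> exact h _ _ _

lemma weights_neg (x : Fin 3 → ℝ) : weights (-x) = weights x := by
  have h (x y z : ℝ) : evenHat (-x) y (-z) = evenHat x (-y) z := by
    simpa using evenHat_neg x (-y) z
  simp [weights, h]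

lemma continuous_weights : Continuous weights := by
  unfold weights evenHat hat
  fun_prop

lemma point_apply (b : Fin 6) (w : Fin 6 → ℝ) : point b w =
    ![edgeSign b 0 * w 0 + edgeSign b 1 * w 1 + edgeSign b 4 * w 4 - edgeSign b 5 * w 5,
      edgeSign b 0 * w 0 - edgeSign b 1 * w 1 + edgeSign b 2 * w 2 + edgeSign b 3 * w 3,
      edgeSign b 2 * w 2 - edgeSign b 3 * w 3 + edgeSign b 4 * w 4 + edgeSign b 5 * w 5] := by
  ext j
  fin_cases j <;> simp [point, axisVec, Fin.sum_univ_succ] <;> ring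

lemma evenHat_of_nonneg {x y z : ℝ} (h : 0 ≤ x) :
    evenHat x y z = max 0 (min ((x + y - |z|) / 2) x) := by
  have : hat (-x) (-y) z = 0 := max_eq_left (min_le_of_right_le (by linarith))
  rw [evenHat, this, add_zero, hat]

lemma evenHat_of_nonpos {x y z : ℝ} (h : x ≤ 0) :
    evenHat x y z = max 0 (min ((-x - y - |z|) / 2) (-x)) := by
  have := evenHat_of_nonneg (x := -x) (y := -y) (z := -z) (by linarith)
  rw [evenHat_neg, abs_neg] at this
  rw [this, ← sub_eq_add_neg]

lemma evenHat_eq (x y z : ℝ) : evenHat x y z =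
    if 0 ≤ x then max 0 (min ((x + y - |z|) / 2) x)
    else max 0 (min ((-x - y - |z|) / 2) (-x)) := by
  split_ifs with h
  · exact evenHat_of_nonneg h
  · exact evenHat_of_nonpos (le_of_not_ge h)

set_option maxHeartbeats 4000000 in
lemma exists_weights_point {F : Finset (Fin 6)} (hF : F ∈ facets) {w : Fin 6 → ℝ}
    (hw : ∀ i, 0 ≤ w i) (hwF : ∀ i ∉ F, w i = 0) : ∃ b ∈ F, weights (point b w) = w := by
  simp only [facets, List.mem_cons, List.not_mem_nil, or_false] at hF
  have h0 := hw 0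
  have h1 := hw 1
  have h2 := hw 2
  have h3 := hw 3
  have h4 := hw 4
  have h5 := hw 5
  rcases hF with rfl | rfl | rfl | rfl | rfl | rfl | rfl | rfl | rfl | rfl
  on_goal 1 => use 0
  on_goal 2 => use 0
  on_goal 3 => use 2
  on_goal 4 => use 2
  on_goal 5 => use 4
  on_goal 6 => use 4
  on_goal 7 => use 0
  on_goal 8 => use 0
  on_goal 9 => use 1
  on_goal 10 => use 1
  all_goals
    refine ⟨by decide, ?_⟩
    have hwF' := And.intro (hwF 0) <| And.intro (hwF 1) <| And.intro (hwF 2) <|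
      And.intro (hwF 3) <| And.intro (hwF 4) (hwF 5)
    simp at hwF'
    rw [point_apply]
    ext i
    fin_cases i <;> simp [weights, edgeSign, hwF'] <;> rw [evenHat_eq] <;> grind

lemma mem_faces_of_mem_facets {F : Finset (Fin 6)} (hF : F ∈ facets) : F ∈ complex.faces := by
  rw [mem_complex, coherent_iff_exists_facet]
  refine ⟨?_, F, hF, subset_rfl⟩
  revert F
  decide

lemma point_smul (b : Fin 6) (t : ℝ) (w : Fin 6 → ℝ) : point b (t • w) = t • point b w := by
  simp only [point, Finset.smul_sum, smul_smul, Pi.smul_apply, smul_eq_mul]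
  exact Finset.sum_congr rfl fun i _ => by ring_nf

/-- Two coherent orientations of a face agree up to a global sign. -/
lemma point_eq_or_eq_neg {F : Finset (Fin 6)} (hF : Coherent F) {w : Fin 6 → ℝ}
    (hwF : ∀ i ∉ F, w i = 0) {b c : Fin 6} (hb : b ∈ F) (hc : c ∈ F) :
    point c w = point b w ∨ point c w = -point b w := by
  have h : point c w = (edgeSign b c : ℝ) • point b w := by
    simp only [point, Finset.smul_sum, smul_smul]
    refine Finset.sum_congr rfl fun i _ => ?_
    by_cases hi : i ∈ F
    · rw [← hF b hb c hc i hi]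
      push_cast
      ring_nf
    · simp [hwF i hi]
  have hs : ∀ i j, edgeSign i j = 1 ∨ edgeSign i j = -1 := by decide
  rcases hs b c with hs | hs <;> simp [h, hs]

lemma weights_point {F : Finset (Fin 6)} (hF : F ∈ facets) {w : Fin 6 → ℝ}
    (hw : ∀ i, 0 ≤ w i) (hwF : ∀ i ∉ F, w i = 0) {b : Fin 6} (hb : b ∈ F) :
    weights (point b w) = w := by
  obtain ⟨c, hc, h⟩ := exists_weights_point hF hw hwF
  have hco := (mem_complex.1 (mem_faces_of_mem_facets hF)).2
  rcases point_eq_or_eq_neg hco hwF hc hb with h' | h' <;> simp [h', weights_neg, h]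

/-- `x` lies in the cone over a triangle of the icosahedral fan or over its antipode. -/
def InFan (x : Fin 3 → ℝ) : Prop :=
  ∃ F ∈ facets, ∃ b ∈ F, ∃ w : Fin 6 → ℝ, (∀ i, 0 ≤ w i) ∧ (∀ i ∉ F, w i = 0) ∧
    (x = point b w ∨ x = -point b w)

lemma InFan.of_neg {x : Fin 3 → ℝ} (h : InFan (-x)) : InFan x := by
  obtain ⟨F, hF, b, hb, w, hw, hwF, h | h⟩ := h
  · exact ⟨F, hF, b, hb, w, hw, hwF, .inr (by rw [← h, neg_neg])⟩
  · exact ⟨F, hF, b, hb, w, hw, hwF, .inl (neg_injective h)⟩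

lemma inFan_of_mem_square {x y z : ℝ} :
    (0 ≤ z → |y| + z ≤ x → InFan ![x, y, z]) ∧ (0 ≤ -z → |y| - z ≤ x → InFan ![x, y, z]) ∧
    (0 ≤ x → |z| + x ≤ y → InFan ![x, y, z]) ∧ (0 ≤ -x → |z| - x ≤ y → InFan ![x, y, z]) ∧
    (0 ≤ y → |x| + y ≤ z → InFan ![x, y, z]) ∧ (0 ≤ -y → |x| - y ≤ z → InFan ![x, y, z]) := by
  refine ⟨fun h₁ h₂ => ⟨{0, 1, 4}, by decide, 0, by decide,
      ![(x - z + y) / 2, (x - z - y) / 2, 0, 0, z, 0], ?_⟩,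
    fun h₁ h₂ => ⟨{0, 1, 5}, by decide, 0, by decide,
      ![(x + z + y) / 2, (x + z - y) / 2, 0, 0, 0, -z], ?_⟩,
    fun h₁ h₂ => ⟨{2, 3, 0}, by decide, 2, by decide,
      ![x, 0, (y - x + z) / 2, (y - x - z) / 2, 0, 0], ?_⟩,
    fun h₁ h₂ => ⟨{2, 3, 1}, by decide, 2, by decide,
      ![0, -x, (y + x + z) / 2, (y + x - z) / 2, 0, 0], ?_⟩,
    fun h₁ h₂ => ⟨{4, 5, 2}, by decide, 4, by decide,
      ![0, 0, y, 0, (z - y + x) / 2, (z - y - x) / 2], ?_⟩,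
    fun h₁ h₂ => ⟨{4, 5, 3}, by decide, 4, by decide,
      ![0, 0, 0, -y, (z + y + x) / 2, (z + y - x) / 2], ?_⟩⟩
  all_goals
    refine ⟨fun i => ?_, fun i => ?_, .inl ?_⟩
    · fin_cases i <;> simp <;> grind
    · fin_cases i <;> simp
    · rw [point_apply]
      ext j
      fin_cases j <;> simp [edgeSign] <;> ring

lemma inFan_of_mem_triangle {x y z : ℝ} :
    (z ≤ x + y → x ≤ y + z → y ≤ x + z → InFan ![x, y, z]) ∧
    (-z ≤ x + y → x ≤ y - z → y ≤ x - z → InFan ![x, y, z]) ∧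
    (z ≤ x - y → x ≤ z - y → -y ≤ x + z → InFan ![x, y, z]) ∧
    (z ≤ y - x → -x ≤ y + z → y ≤ z - x → InFan ![x, y, z]) := by
  refine ⟨fun h₁ h₂ h₃ => ⟨{0, 2, 4}, by decide, 0, by decide,
      ![(x + y - z) / 2, 0, (y + z - x) / 2, 0, (x + z - y) / 2, 0], ?_⟩,
    fun h₁ h₂ h₃ => ⟨{0, 3, 5}, by decide, 0, by decide,
      ![(x + y + z) / 2, 0, 0, (y - z - x) / 2, 0, (x - z - y) / 2], ?_⟩,
    fun h₁ h₂ h₃ => ⟨{1, 3, 4}, by decide, 1, by decide,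
      ![0, (x - y - z) / 2, 0, (z - y - x) / 2, (x + z + y) / 2, 0], ?_⟩,
    fun h₁ h₂ h₃ => ⟨{1, 2, 5}, by decide, 2, by decide,
      ![0, (y - x - z) / 2, (y + z + x) / 2, 0, 0, (z - x - y) / 2], ?_⟩⟩
  all_goals
    refine ⟨fun i => ?_, fun i => ?_, .inl ?_⟩
    · fin_cases i <;> simp <;> linarith
    · fin_cases i <;> simp
    · rw [point_apply]
      ext j
      fin_cases j <;> simp [edgeSign] <;> ring

lemma inFan (x : Fin 3 → ℝ) : InFan x := by
  obtain ⟨x, y, z, rfl⟩ : ∃ a b c, x = ![a, b, c] :=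
    ⟨x 0, x 1, x 2, by ext i; fin_cases i <;> rfl⟩
  by_contra hP
  have hN : ¬ InFan ![-x, -y, -z] := fun h => hP (.of_neg (by simpa using h))
  have h₁ := inFan_of_mem_square (x := x) (y := y) (z := z)
  have h₂ := inFan_of_mem_square (x := -x) (y := -y) (z := -z)
  have h₃ := inFan_of_mem_triangle (x := x) (y := y) (z := z)
  have h₄ := inFan_of_mem_triangle (x := -x) (y := -y) (z := -z)
  simp only [hP, hN, imp_false, abs_neg, neg_neg] at h₁ h₂ h₃ h₄
  rcases abs_cases x with ⟨hx, _⟩ | ⟨hx, _⟩ <;> rcases abs_cases y with ⟨hy, _⟩ | ⟨hy, _⟩ <;>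
    rcases abs_cases z with ⟨hz, _⟩ | ⟨hz, _⟩ <;> rw [hx, hy, hz] at h₁ h₂ <;> grind

lemma weights_spec (x : Fin 3 → ℝ) : ∃ F ∈ facets, (∀ i ∉ F, weights x i = 0) ∧
    ∀ b ∈ F, x = point b (weights x) ∨ x = -point b (weights x) := by
  obtain ⟨F, hF, b, hb, w, hw, hwF, h⟩ := inFan x
  have hwx : weights x = w := by
    rcases h with rfl | rfl
    · exact weights_point hF hw hwF hb
    · rw [weights_neg, weights_point hF hw hwF hb]
  rw [hwx]
  refine ⟨F, hF, hwF, fun c hc => ?_⟩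
  have hco := (mem_complex.1 (mem_faces_of_mem_facets hF)).2
  rcases h with rfl | rfl <;>
    rcases point_eq_or_eq_neg hco hwF hb hc with h' | h' <;> simp [h']

lemma weights_smul {t : ℝ} (ht : 0 ≤ t) (x : Fin 3 → ℝ) : weights (t • x) = t • weights x := by
  have h (a b c : ℝ) : hat (t * a) (t * b) (t * c) = t * hat a b c := by
    rw [hat, hat, mul_max_of_nonneg _ _ ht, mul_min_of_nonneg _ _ ht, abs_mul, abs_of_nonneg ht]
    ring_nf
  have h' (a b c : ℝ) : evenHat (t * a) (t * b) (t * c) = t * evenHat a b c := by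
    rw [evenHat, evenHat, ← mul_neg, ← mul_neg, h, h, mul_add]
  simp [weights, ← mul_neg, h']

lemma sum_weights_pos {x : Fin 3 → ℝ} (hx : x ≠ 0) : 0 < ∑ i, weights x i := by
  refine (Finset.sum_nonneg fun i _ => weights_nonneg x i).lt_of_ne fun h => hx ?_
  have h0 : weights x = 0 := funext fun i =>
    (Finset.sum_eq_zero_iff_of_nonneg fun i _ => weights_nonneg x i).1 h.symm i (Finset.mem_univ i)
  obtain ⟨F, hF, -, hx⟩ := weights_spec x
  obtain ⟨b, hb⟩ := (mem_complex.1 (mem_faces_of_mem_facets hF)).1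
  have hp : point b 0 = 0 := by simp [point]
  simpa [h0, hp] using hx b hb

open Metric

lemma subsingleton_of_isQuotientCoveringMap {E X G : Type*}
    [TopologicalSpace E] [TopologicalSpace X] [Group G] [MulAction G E] {f : E → X}
    (hf : IsQuotientCoveringMap f G) [PathConnectedSpace E] [SimplyConnectedSpace X] :
    Subsingleton G := by
  obtain ⟨e⟩ : Nonempty E := inferInstance
  have h := hf.fundamentalGroupToMulOpposite_surjective (x := f e) ⟨e, rfl⟩
  have : Subsingleton (Gᵐᵒᵖ) := h.subsingleton
  exact MulOpposite.op_injective.subsingleton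

/-- The unit sphere of `ℝ³`. -/
abbrev Sphere : Type := sphere (0 : EuclideanSpace ℝ (Fin 3)) 1

/-- The antipodal quotient map. -/
def toRP2 : Sphere → RP2 := Quot.mk _

lemma toRP2_eq_iff {x y : Sphere} : toRP2 x = toRP2 y ↔ x = y ∨ x = -y := by
  refine ⟨fun h => ?_, fun h => Quot.sound ?_⟩
  · have h' := Quot.eqvGen_exact h
    clear h
    induction h' with
    | rel x y h => exact h.imp Subtype.ext Subtype.ext
    | refl x => exact .inl rfl
    | symm x y _ ih => rcases ih with rfl | rfl <;> simp
    | trans x y z _ _ ih₁ ih₂ => rcases ih₁ with rfl | rfl <;> rcases ih₂ with rfl | rfl <;> simp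
  · rcases h with rfl | rfl <;> simp

lemma unit_eq_one_or_neg_one (g : sphere (0 : ℝ) 1) : g = 1 ∨ g = -1 := by
  have h : |(g : ℝ)| = 1 := norm_eq_of_mem_sphere g
  rcases eq_or_eq_neg_of_abs_eq h with h | h
  · exact .inl (Subtype.ext h)
  · exact .inr (Subtype.ext h)

lemma neg_one_smul_sphere (x : Sphere) : (-1 : sphere (0 : ℝ) 1) • x = -x :=
  Subtype.ext (neg_one_smul ℝ (x : EuclideanSpace ℝ (Fin 3)))

lemma isQuotientMap_toRP2 : Topology.IsQuotientMap toRP2 := isQuotientMap_quot_mk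

lemma isQuotientCoveringMap_toRP2 : IsQuotientCoveringMap toRP2 (sphere (0 : ℝ) 1) where
  __ := isQuotientMap_toRP2
  continuous_const_smul g := continuous_const_smul g
  apply_eq_iff_mem_orbit {x y} := by
    rw [toRP2_eq_iff, MulAction.mem_orbit_iff]
    constructor
    · rintro (rfl | rfl)
      · exact ⟨1, one_smul _ _⟩
      · exact ⟨-1, neg_one_smul_sphere y⟩
    · rintro ⟨g, rfl⟩
      rcases unit_eq_one_or_neg_one g with rfl | rfl
      · exact .inl (one_smul _ _)
      · exact .inr (neg_one_smul_sphere y)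
  disjoint x := by
    refine ⟨ball x 1, ball_mem_nhds x one_pos, fun g hg => ?_⟩
    rcases unit_eq_one_or_neg_one g with rfl | rfl
    · rfl
    obtain ⟨_, ⟨y, hy, rfl⟩, hy'⟩ := hg
    simp only [neg_one_smul_sphere] at hy'
    have h := dist_triangle_right y (-y) x
    have h2 : dist y (-y) = 2 := by
      rw [Subtype.dist_eq, coe_neg_sphere, dist_eq_norm, sub_neg_eq_add, ← two_smul ℝ, norm_smul]
      simp
    rw [mem_ball] at hy hy'
    linarith

lemma not_contractibleSpace_RP2 : ¬ ContractibleSpace RP2 := by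
  intro _
  have : PathConnectedSpace Sphere := isPathConnected_iff_pathConnectedSpace.1
    (isPathConnected_sphere (by simp [← Module.finrank_eq_rank]) _ zero_le_one)
  have := subsingleton_of_isQuotientCoveringMap isQuotientCoveringMap_toRP2
  have h : (1 : sphere (0 : ℝ) 1) = -1 := Subsingleton.elim _ _
  have h' : (1 : ℝ) = -1 := congrArg Subtype.val h
  norm_num at h'

lemma sphere_ne_zero (x : Sphere) : (x : EuclideanSpace ℝ (Fin 3)).ofLp ≠ 0 := fun h =>
  ne_zero_of_mem_unit_sphere x (WithLp.ofLp_injective 2 h)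

/-- The even map from the sphere to the realization given by normalized weights. -/
noncomputable def toRealization (x : Sphere) : realization complex :=
  ⟨(∑ i, weights (x : EuclideanSpace ℝ (Fin 3)) i)⁻¹ • weights (x : EuclideanSpace ℝ (Fin 3)), by
    have hpos := sum_weights_pos (sphere_ne_zero x)
    obtain ⟨F, hF, hwF, -⟩ := weights_spec (x : EuclideanSpace ℝ (Fin 3))
    refine ⟨F, mem_faces_of_mem_facets hF,
      fun v => mul_nonneg (inv_nonneg.2 hpos.le) (weights_nonneg _ v),
      fun v hv => by simp [hwF v hv], ?_⟩
    simp only [Pi.smul_apply, smul_eq_mul]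
    rw [← Finset.mul_sum, Finset.sum_subset (Finset.subset_univ F) fun i _ => hwF i]
    exact inv_mul_cancel₀ hpos.ne'⟩

lemma continuous_toRealization : Continuous toRealization := by
  have h : Continuous fun x : Sphere => weights (x : EuclideanSpace ℝ (Fin 3)) :=
    continuous_weights.comp ((PiLp.continuous_ofLp 2 _).comp continuous_subtype_val)
  have hsum : Continuous fun x : Sphere => ∑ i, weights (x : EuclideanSpace ℝ (Fin 3)) i :=
    continuous_finsetSum _ fun i _ => (continuous_apply i).comp h
  exact ((hsum.inv₀ fun x => (sum_weights_pos (sphere_ne_zero x)).ne').smul h).subtype_mk _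

lemma toRealization_neg (x : Sphere) : toRealization (-x) = toRealization x := by
  simp [toRealization, weights_neg]

lemma eq_or_eq_neg_of_toRealization_eq {x y : Sphere} (h : toRealization x = toRealization y) :
    x = y ∨ x = -y := by
  have hx := sum_weights_pos (sphere_ne_zero x)
  have hy := sum_weights_pos (sphere_ne_zero y)
  obtain ⟨r, hr, hxy⟩ : ∃ r > (0 : ℝ), weights (x : EuclideanSpace ℝ (Fin 3)) =
      r • weights (y : EuclideanSpace ℝ (Fin 3)) := by
    refine ⟨_, mul_pos hx (inv_pos.2 hy), ?_⟩
    have hv := congrArg Subtype.val h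
    simp only [toRealization] at hv
    rw [mul_smul, ← hv, smul_inv_smul₀ hx.ne']
  obtain ⟨F, hF, hwF, hxF⟩ := weights_spec (x : EuclideanSpace ℝ (Fin 3))
  obtain ⟨G, hG, hwG, hyG⟩ := weights_spec (y : EuclideanSpace ℝ (Fin 3))
  obtain ⟨i, -, hi⟩ := Finset.exists_ne_zero_of_sum_ne_zero hy.ne'
  have hiG : i ∈ G := by_contra fun h => hi (hwG i h)
  have hiF : i ∈ F := by_contra fun h => by
    have := hwF i h
    rw [hxy, Pi.smul_apply, smul_eq_mul, mul_eq_zero] at this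
    exact this.elim hr.ne' hi
  have key : (x : EuclideanSpace ℝ (Fin 3)) = r • (y : EuclideanSpace ℝ (Fin 3)) ∨
      (x : EuclideanSpace ℝ (Fin 3)) = -(r • (y : EuclideanSpace ℝ (Fin 3))) := by
    have hx' := hxF i hiF
    have hy' := hyG i hiG
    rw [hxy, point_smul] at hx'
    generalize point i (weights (y : EuclideanSpace ℝ (Fin 3)).ofLp) = p at hx' hy'
    refine Or.imp (fun h => WithLp.ofLp_injective 2 h) (fun h => WithLp.ofLp_injective 2 h) ?_
    rcases hx' with h | h <;> rcases hy' with h' | h' <;> simp [h, h']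
  have hr1 : r = 1 := by
    have hnx := norm_eq_of_mem_sphere x
    rcases key with h | h <;> rw [h] at hnx <;>
      simpa [norm_smul, abs_of_pos hr] using hnx
  subst hr1
  rw [one_smul] at key
  exact key.imp Subtype.ext Subtype.ext

lemma toRealization_surjective : Function.Surjective toRealization := by
  rintro ⟨w, σ, hσ, hw, hwσ, hsum⟩
  obtain ⟨F, hF, hσF⟩ := (coherent_iff_exists_facet σ).1 (mem_complex.1 hσ).2
  obtain ⟨b, hb⟩ := (mem_complex.1 hσ).1
  have hwp := weights_point hF hw (fun i hi => hwσ i fun h => hi (hσF h)) (hσF hb)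
  rw [Finset.sum_subset (Finset.subset_univ σ) fun i _ => hwσ i] at hsum
  set p : EuclideanSpace ℝ (Fin 3) := WithLp.toLp 2 (point b w) with hp
  have hp0 : p ≠ 0 := by
    intro h0
    have hz : point b w = 0 := congrArg WithLp.ofLp h0
    have h := weights_smul le_rfl (point b w)
    rw [zero_smul, zero_smul, ← hz, hwp] at h
    simp [h] at hsum
  have hn : 0 < ‖p‖⁻¹ := inv_pos.2 (norm_pos_iff.2 hp0)
  refine ⟨⟨‖p‖⁻¹ • p, by simp [norm_smul, hp0]⟩, Subtype.ext ?_⟩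
  have h : weights (‖p‖⁻¹ • p).ofLp = ‖p‖⁻¹ • w := by
    rw [WithLp.ofLp_smul, weights_smul hn.le, hp, WithLp.ofLp_toLp, hwp]
  simp only [toRealization, h, Pi.smul_apply, smul_eq_mul]
  rw [← Finset.mul_sum, hsum, mul_one, inv_smul_smul₀ hn.ne']

/-- The realization of the six-vertex complex is the projective plane. -/
noncomputable def homeomorphRP2 : RP2 ≃ₜ realization complex :=
  have : CompactSpace RP2 :=
    isQuotientMap_toRP2.surjective.compactSpace isQuotientMap_toRP2.continuous
  let f : RP2 → realization complex := Quot.lift toRealization fun x y h => by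
    rcases h with h | h
    · rw [Subtype.ext h]
    · rw [show x = -y from Subtype.ext h, toRealization_neg]
  have hf : Continuous f := isQuotientMap_toRP2.continuous_iff.2 continuous_toRealization
  have hbij : Function.Bijective f := by
    refine ⟨?_, fun w => ?_⟩
    · rintro ⟨x⟩ ⟨y⟩ h
      exact toRP2_eq_iff.2 (eq_or_eq_neg_of_toRealization_eq h)
    · obtain ⟨x, rfl⟩ := toRealization_surjective w
      exact ⟨toRP2 x, rfl⟩
  Continuous.homeoOfEquivCompactToT2 (f := Equiv.ofBijective f hbij) hf

end HemiIcosahedron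

/-- The real projective plane admits a triangulation (on 6 vertices) with
discrete Morse vector `(1,1,1)`, yet it is not contractible: a `2`-complex with
Morse vector `(1,1,1)` need not be contractible. -/
theorem rp2_morse111_not_contractible :
    ∃ C : SimplicialCx (Fin 6),
      HasMorseVector111 C ∧
      Nonempty (↥(realization C) ≃ₜ RP2) ∧
      ¬ ContractibleSpace ↥(realization C) := by
  refine ⟨HemiIcosahedron.complex, HemiIcosahedron.hasMorseVector111,
    ⟨HemiIcosahedron.homeomorphRP2.symm⟩, fun _ => HemiIcosahedron.not_contractibleSpace_RP2 ?_⟩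
  exact HemiIcosahedron.homeomorphRP2.contractibleSpace
end
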